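/- arXiv:2003.09101 — 5 statements merged into one kernel-verified Lean document; each statement's English description precedes it below -/
import Mathlib

section
/- Let k be a field and d a positive integer. For every ideal I of the polynomial ring k[X_1,…,X_d] there exist d elements f_1,…,f_d ∈ I such that the radical of the ideal generated by f_1,…,f_d equals the radical of I. -/
open Polynomial in
/-- Domain case: one element suffices after inverting a nonzero constant. -/
theorem see_domain {D : Type*} [CommRing D] [IsDomain D] (I : Ideal D[X]) :
    ∃ g ∈ I, ∃ c : D, c ≠ 0 ∧ ∀ P : Ideal D[X], P.IsPrime → g ∈ P →
      ∀ f ∈ I, C c * f ∈ P := by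
  classical
  by_cases h : ∃ n, ∃ g ∈ I, g ≠ 0 ∧ g.natDegree = n
  · obtain ⟨g, hgI, hg0, hgn⟩ := Nat.find_spec h
    refine ⟨g, hgI, g.leadingCoeff, by simpa using hg0, fun P hP hgP => ?_⟩
    have hmin : ∀ f ∈ I, f ≠ 0 → g.natDegree ≤ f.natDegree := fun f hf hf0 => by
      rw [hgn]; exact Nat.find_min' h ⟨f, hf, hf0, rfl⟩
    suffices H : ∀ n, ∀ f ∈ I, f.natDegree < n → C g.leadingCoeff * f ∈ P from
      fun f hf => H _ f hf (Nat.lt_succ_self _)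
    intro n
    induction n with
    | zero => intro f _ h; omega
    | succ n ih =>
      intro f hf hn
      by_cases hf0 : f = 0
      · simp [hf0]
      have hle := hmin f hf hf0
      set f' := C g.leadingCoeff * f - C f.leadingCoeff * X ^ (f.natDegree - g.natDegree) * g
        with hf'
      have hf'I : f' ∈ I := I.sub_mem (I.mul_mem_left _ hf) (I.mul_mem_left _ hgI)
      have hfm : f' ∈ P ∨ C g.leadingCoeff ∈ P := by
        by_cases hf'0 : f' = 0
        · left; simp [hf'0]
        have hdeg : f'.degree < f.degree := by
          have hc : g.leadingCoeff ≠ 0 := by simpa using hg0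
          have hc' : f.leadingCoeff ≠ 0 := by simpa using hf0
          have h1 : (C g.leadingCoeff * f).degree = f.degree := by
            rw [degree_mul, degree_C hc, zero_add]
          have h2 : (C f.leadingCoeff * X ^ (f.natDegree - g.natDegree) * g).degree
              = f.degree := by
            rw [degree_mul, degree_mul, degree_C hc', degree_X_pow, zero_add,
              degree_eq_natDegree hg0, degree_eq_natDegree hf0, ← Nat.cast_add]
            congr 1; omega
          rw [← h1]
          refine degree_sub_lt_left (h1.trans h2.symm) (by
            rw [← degree_ne_bot, h1, degree_ne_bot]; exact hf0) ?_
          rw [leadingCoeff_mul, leadingCoeff_mul, leadingCoeff_mul, leadingCoeff_C, leadingCoeff_C,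
            leadingCoeff_X_pow, mul_one, mul_comm]
        have := natDegree_lt_natDegree hf'0 hdeg
        exact (hP.mem_or_mem (ih f' hf'I (by omega))).symm
      rcases hfm with h1 | h1
      · have : C g.leadingCoeff * f
            = f' + C f.leadingCoeff * X ^ (f.natDegree - g.natDegree) * g := by
          rw [hf']; ring
        rw [this]
        exact P.add_mem h1 (P.mul_mem_left _ hgP)
      · exact P.mul_mem_right _ h1
  · refine ⟨0, I.zero_mem, 1, one_ne_zero, fun P hP _ f hf => ?_⟩
    have : f = 0 := by
      by_contra hf0
      exact h ⟨_, f, hf, hf0, rfl⟩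
    simp [this]

open Polynomial in
/-- The version relative to a prime of the base. -/
theorem see_prime {S : Type*} [CommRing S] (I : Ideal S[X]) (p : Ideal S) (hp : p.IsPrime) :
    ∃ g ∈ I, ∃ c : S, c ∉ p ∧ ∀ P : Ideal S[X], P.IsPrime → p ≤ P.comap C → g ∈ P →
      ∀ f ∈ I, C c * f ∈ P := by
  let φ : S[X] →+* (S ⧸ p)[X] := mapRingHom (Ideal.Quotient.mk p)
  have hφ : Function.Surjective φ := map_surjective _ Ideal.Quotient.mk_surjective
  obtain ⟨g', hg', c', hc', H⟩ := see_domain (I.map φ)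
  obtain ⟨g, hg, rfl⟩ := (Ideal.mem_map_iff_of_surjective φ hφ).1 hg'
  obtain ⟨c, rfl⟩ := Ideal.Quotient.mk_surjective c'
  refine ⟨g, hg, c, fun h => hc' (Ideal.Quotient.eq_zero_iff_mem.2 h), ?_⟩
  intro P hP hpP hgP f hf
  have hker : RingHom.ker φ ≤ P := by
    rw [Polynomial.ker_mapRingHom, Ideal.mk_ker]
    exact Ideal.map_le_iff_le_comap.2 hpP
  have hPc : (P.map φ).comap φ = P := by
    rw [Ideal.comap_map_of_surjective' φ hφ, sup_eq_left.2 hker]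
  have := H (P.map φ) (Ideal.map_isPrime_of_surjective hφ hker) (Ideal.mem_map_of_mem _ hgP)
    (φ f) (Ideal.mem_map_of_mem _ hf)
  rw [← hPc, Ideal.mem_comap, map_mul]
  simpa [φ] using this

open Polynomial in
/-- Gluing over all minimal primes. -/
theorem see_glue {S : Type*} [CommRing S] [IsNoetherianRing S] (I : Ideal S[X]) :
    ∃ g ∈ I, ∃ t : S, (∀ p ∈ minimalPrimes S, t ∉ p) ∧ ∀ P : Ideal S[X], P.IsPrime → g ∈ P →
      ∀ f ∈ I, C t * f ∈ P := by
  classical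
  have hfin : (minimalPrimes S).Finite := minimalPrimes.finite_of_isNoetherianRing S
  let F := hfin.toFinset
  have hF : ∀ p, p ∈ F ↔ p ∈ minimalPrimes S := fun p => hfin.mem_toFinset
  have hpr : ∀ p ∈ minimalPrimes S, p.IsPrime := fun p hp => hp.1.1
  have he : ∀ p : Ideal S, ∃ e : S, p ∈ minimalPrimes S →
      e ∉ p ∧ ∀ q ∈ minimalPrimes S, q ≠ p → e ∈ q := by
    intro p
    by_cases hp : p ∈ minimalPrimes S
    · have hnot : ¬ ((F.erase p).inf id ≤ p) := by
        intro hle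
        obtain ⟨q, hq, hqp⟩ := ((hpr p hp).inf_le').1 hle
        rw [Finset.mem_erase, hF] at hq
        exact hq.1 (le_antisymm hqp (hp.2 hq.2.1 hqp))
      obtain ⟨e, he, hep⟩ := SetLike.not_le_iff_exists.1 hnot
      refine ⟨e, fun _ => ⟨hep, fun q hq hqp => ?_⟩⟩
      have : (F.erase p).inf id ≤ q :=
        Finset.inf_le (f := id) (Finset.mem_erase.2 ⟨hqp, (hF q).2 hq⟩)
      exact this he
    · exact ⟨0, fun h => absurd h hp⟩
  choose e he using he
  have hg : ∀ p : Ideal S, ∃ g ∈ I, ∃ c : S, p ∈ minimalPrimes S → (c ∉ p ∧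
      ∀ P : Ideal S[X], P.IsPrime → p ≤ P.comap C → g ∈ P → ∀ f ∈ I, C c * f ∈ P) := by
    intro p
    by_cases hp : p ∈ minimalPrimes S
    · obtain ⟨g, hg, c, hc⟩ := see_prime I p (hpr p hp)
      exact ⟨g, hg, c, fun _ => hc⟩
    · exact ⟨0, I.zero_mem, 0, fun h => absurd h hp⟩
  choose g hgI c hc using hg
  refine ⟨∑ p ∈ F, C (e p) * g p, I.sum_mem fun p _ => I.mul_mem_left _ (hgI p),
    ∑ p ∈ F, e p * c p, ?_, ?_⟩
  · intro p hp ht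
    rw [← Finset.add_sum_erase F _ ((hF p).2 hp)] at ht
    have h2 : ∑ q ∈ F.erase p, e q * c q ∈ p := p.sum_mem fun q hq => by
      rw [Finset.mem_erase, hF] at hq
      exact p.mul_mem_right _ ((he q hq.2).2 p hp hq.1.symm)
    have h3 := (p.add_mem_iff_left h2).1 ht
    rcases (hpr p hp).mem_or_mem h3 with h | h
    · exact (he p hp).1 h
    · exact (hc p hp).1 h
  · intro P hP hgP f hf
    obtain ⟨p, hp, hpP⟩ := Ideal.exists_minimalPrimes_le (I := (⊥ : Ideal S))
      (J := P.comap C) bot_le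
    have hp : p ∈ minimalPrimes S := hp
    rw [← Finset.add_sum_erase F _ ((hF p).2 hp)] at hgP ⊢
    have h2 : ∑ q ∈ F.erase p, C (e q) * g q ∈ P := P.sum_mem fun q hq => by
      rw [Finset.mem_erase, hF] at hq
      exact P.mul_mem_right _ (hpP ((he q hq.2).2 p hp hq.1.symm))
    have h3 := (P.add_mem_iff_left h2).1 hgP
    have h4 : C (∑ q ∈ F.erase p, e q * c q) ∈ P := by
      have : ∑ q ∈ F.erase p, e q * c q ∈ P.comap C := Ideal.sum_mem _ fun q hq => by
        rw [Finset.mem_erase, hF] at hq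
        exact Ideal.mul_mem_right _ _ (hpP ((he q hq.2).2 p hp hq.1.symm))
      exact this
    rw [C_add, add_mul]
    refine P.add_mem ?_ (P.mul_mem_right _ h4)
    rw [C_mul, mul_assoc]
    rcases hP.mem_or_mem h3 with h | h
    · exact P.mul_mem_right _ h
    · exact P.mul_mem_left _ ((hc p hp).2 P hP hpP h f hf)

theorem see_dim {R : Type*} [CommRing R] {r : R} (hr : ∀ p ∈ minimalPrimes R, r ∉ p) :
    ringKrullDim (R ⧸ Ideal.span {r}) + 1 ≤ ringKrullDim R := by
  by_cases hr' : Ideal.span {r} = ⊤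
  · have : Subsingleton (R ⧸ Ideal.span {r}) := Ideal.Quotient.subsingleton_iff.2 hr'
    rw [ringKrullDim_eq_bot_of_subsingleton]
    simp
  have : Nonempty (PrimeSpectrum.zeroLocus (R := R) (Ideal.span {r})) := by
    rwa [Set.nonempty_coe_sort, Set.nonempty_iff_ne_empty, ne_eq,
      PrimeSpectrum.zeroLocus_empty_iff_eq_top]
  have := Ideal.Quotient.nontrivial_iff.mpr hr'
  have := (Ideal.Quotient.mk (Ideal.span {r})).domain_nontrivial
  rw [ringKrullDim_quotient, Order.krullDim_eq_iSup_length, ringKrullDim,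
    Order.krullDim_eq_iSup_length, ← WithBot.coe_one, ← WithBot.coe_add,
    ENat.iSup_add, WithBot.coe_le_coe, iSup_le_iff]
  intro l
  obtain ⟨p, hp, hp'⟩ := Ideal.exists_minimalPrimes_le (J := l.head.1.asIdeal) bot_le
  let p' : PrimeSpectrum R := ⟨p, hp.1.1⟩
  have hrl : r ∈ l.head.1.asIdeal := by
    have := l.head.2
    rw [PrimeSpectrum.mem_zeroLocus] at this
    exact this (Ideal.mem_span_singleton_self r)
  have hp' : p' < l.head.1 := lt_of_le_of_ne hp' fun h => hr p hp (by
    rw [← h] at hrl; exact hrl)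
  have hmono : StrictMono (Subtype.val : PrimeSpectrum.zeroLocus (R := R) (Ideal.span {r}) → _) :=
    fun _ _ h => h
  let L : LTSeries (PrimeSpectrum R) := RelSeries.cons (l.map Subtype.val hmono) p' hp'
  have hL : L.length = l.length + 1 := by
    have h := RelSeries.cons_length (l.map Subtype.val hmono) p' hp'
    exact h
  refine le_trans (le_of_eq ?_) (le_iSup (fun q : LTSeries (PrimeSpectrum R) => (q.length : ℕ∞)) L)
  simp only [hL]
  push_cast
  rfl

open Polynomial in
theorem see_main (n : ℕ) : ∀ (S : Type*) [CommRing S] [IsNoetherianRing S],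
    ringKrullDim S < n → ∀ I : Ideal S[X], ∃ f : Fin n → S[X], (∀ i, f i ∈ I) ∧
      ∀ P : Ideal S[X], P.IsPrime → (∀ i, f i ∈ P) → I ≤ P := by
  induction n with
  | zero =>
    intro S _ _ hS I
    have : Subsingleton S := by
      by_contra h
      rw [not_subsingleton_iff_nontrivial] at h
      exact absurd ringKrullDim_nonneg_of_nontrivial (not_le.2 (by simpa using hS))
    refine ⟨fun _ => 0, fun i => I.zero_mem, fun P hP _ => ?_⟩
    exact absurd (Subsingleton.elim _ _) hP.ne_top
  | succ n ih =>
    intro S _ _ hS I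
    obtain ⟨g, hg, t, ht, H⟩ := see_glue I
    have hdim : ringKrullDim (S ⧸ Ideal.span {t}) < n := by
      have := (see_dim ht).trans_lt hS
      push_cast at this
      exact lt_of_add_lt_add_right this
    let φ : S[X] →+* (S ⧸ Ideal.span {t})[X] := mapRingHom (Ideal.Quotient.mk _)
    have hφ : Function.Surjective φ := map_surjective _ Ideal.Quotient.mk_surjective
    obtain ⟨f', hf', H'⟩ := ih _ hdim (I.map φ)
    choose f hf hff' using fun i => (Ideal.mem_map_iff_of_surjective φ hφ).1 (hf' i)
    refine ⟨Fin.cons g f, fun i => Fin.cases hg hf i, fun P hP hfP => ?_⟩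
    by_cases htP : C t ∈ P
    · have hker : RingHom.ker φ ≤ P := by
        rw [Polynomial.ker_mapRingHom, Ideal.mk_ker]
        exact Ideal.map_le_iff_le_comap.2 ((Ideal.span_singleton_le_iff_mem _).2 htP)
      have hPc : (P.map φ).comap φ = P := by
        rw [Ideal.comap_map_of_surjective' φ hφ, sup_eq_left.2 hker]
      rw [← hPc]
      refine Ideal.map_le_iff_le_comap.1
        (H' _ (Ideal.map_isPrime_of_surjective hφ hker) fun i => ?_)
      rw [← hff']
      exact Ideal.mem_map_of_mem _ (hfP i.succ)
    · intro x hx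
      exact (hP.mem_or_mem (H P hP (hfP 0) x hx)).resolve_left htP

/-- **Storch; Eisenbud–Evans.** Every ideal of a polynomial ring in `d` variables
over a field is defined set-theoretically by `d` elements. -/
theorem storch_eisenbud_evans_set_theoretic (k : Type*) [Field k] (d : ℕ) (hd : 0 < d)
    (I : Ideal (MvPolynomial (Fin d) k)) :
    ∃ f : Fin d → MvPolynomial (Fin d) k,
      (∀ i, f i ∈ I) ∧ (Ideal.span (Set.range f)).radical = I.radical := by
  obtain ⟨n, rfl⟩ : ∃ n, d = n + 1 := ⟨d - 1, by omega⟩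
  let e := (MvPolynomial.finSuccEquiv k n).toRingEquiv
  have hdim : ringKrullDim (MvPolynomial (Fin n) k) < (n + 1 : ℕ) := by
    rw [MvPolynomial.ringKrullDim_of_isNoetherianRing, ringKrullDim_eq_zero_of_field, zero_add,
      Nat.card_eq_fintype_card, Fintype.card_fin]
    exact_mod_cast Nat.lt_succ_self n
  obtain ⟨f, hf, H⟩ := see_main (n + 1) _ hdim (I.comap e.symm)
  refine ⟨fun i => e.symm (f i), hf, le_antisymm ?_ ?_⟩
  · exact Ideal.radical_mono (Ideal.span_le.2 (by rintro _ ⟨i, rfl⟩; exact hf i))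
  · rw [Ideal.radical_le_radical_iff, Ideal.radical_eq_sInf]
    refine le_sInf fun P hP => ?_
    obtain ⟨hle, hP⟩ := hP
    have := H (P.comap e.symm) (Ideal.comap_isPrime _ _)
      fun i => hle (Ideal.subset_span ⟨i, rfl⟩)
    intro x hx
    have h2 : e x ∈ P.comap e.symm := this (by simpa [Ideal.mem_comap] using hx)
    simpa [Ideal.mem_comap] using h2
end

section
/- Let k be a field and let a_1, a_2, a_3 be positive integers with gcd(a_1,a_2,a_3) = 1. Let p(a) ⊆ k[X_1,X_2,X_3] be the kernel of the k-algebra homomorphism k[X_1,X_2,X_3] → k[T] sending X_i to T^{a_i}. Then there exist two polynomials f, g ∈ p(a) such that √(f,g) = p(a); that is, every monomial curve in A^3 is a set-theoretic complete intersection. -/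
/-- The prime ideal defining the monomial curve `C(a)`: the kernel of the `k`-algebra
map `k[X_1, …, X_d] → k[T]`, `X_i ↦ T^{a i}`. -/
noncomputable def monomialCurveIdeal (k : Type*) [Field k] {d : ℕ} (a : Fin d → ℕ) :
    Ideal (MvPolynomial (Fin d) k) :=
  RingHom.ker (MvPolynomial.aeval (R := k) fun i => (Polynomial.X : Polynomial k) ^ a i)

/-- Arithmetic data: a suitable oriented basis of the lattice of relations. -/
theorem mc_arith (a b c : ℕ) (ha : 0 < a) (hb : 0 < b) (hc : 0 < c) :
    ∃ r s t u v w : ℕ, 0 < r ∧ r * a = s * b + t * c ∧ r * v + s * u = c ∧ r * w = b + t * u ∧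
      s * w + t * v = a ∧ ∀ i ≤ r, w * i ≤ b + t * (u * i / r) := by
  classical
  have hex : ∃ r : ℕ, 0 < r ∧ ∃ s t : ℕ, r * a = s * b + t * c := ⟨b, hb, a, 0, by ring⟩
  obtain ⟨hr, s, t, hst⟩ := Nat.find_spec hex
  have hmin : ∀ r' s' t' : ℕ, 0 < r' → r' * a = s' * b + t' * c → Nat.find hex ≤ r' :=
    fun r' s' t' h1 h2 => Nat.find_min' hex ⟨h1, s', t', h2⟩
  generalize Nat.find hex = r at *
  -- primitivity
  have hg : Nat.gcd r (Nat.gcd s t) = 1 := by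
    obtain ⟨r', hr'⟩ := Nat.gcd_dvd_left r (Nat.gcd s t)
    obtain ⟨s', hs'⟩ := (Nat.gcd_dvd_right r (Nat.gcd s t)).trans (Nat.gcd_dvd_left s t)
    obtain ⟨t', ht'⟩ := (Nat.gcd_dvd_right r (Nat.gcd s t)).trans (Nat.gcd_dvd_right s t)
    have hd : 0 < Nat.gcd r (Nat.gcd s t) := Nat.gcd_pos_of_pos_left _ hr
    generalize Nat.gcd r (Nat.gcd s t) = d at *
    have hr'0 : 0 < r' := by
      rcases Nat.eq_zero_or_pos r' with h | h
      · subst h; omega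
      · exact h
    have h := hmin r' s' t' hr'0 (by
      apply Nat.eq_of_mul_eq_mul_left hd
      rw [hr', hs', ht'] at hst
      linarith)
    by_contra hne
    have : 2 ≤ d := by omega
    nlinarith
  obtain ⟨α, β, γ, hbez⟩ : ∃ α β γ : ℤ, α * r + β * s + γ * t = 1 := by
    have h1 := Nat.gcd_eq_gcd_ab r (Nat.gcd s t)
    have h2 := Nat.gcd_eq_gcd_ab s t
    rw [hg] at h1
    refine ⟨Nat.gcdA r (Nat.gcd s t), Nat.gcdB r (Nat.gcd s t) * Nat.gcdA s t,
      Nat.gcdB r (Nat.gcd s t) * Nat.gcdB s t, ?_⟩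
    rw [h2] at h1
    push_cast at h1
    linear_combination -h1
  have hstZ : (r : ℤ) * a = s * b + t * c := by exact_mod_cast hst
  have hrZ : (0 : ℤ) < r := by exact_mod_cast hr
  obtain ⟨u, v, w, hu0, hur, e1, e2⟩ : ∃ u v w : ℤ, 0 ≤ u ∧ u < r ∧ r * v + s * u = c ∧
      r * w = b + t * u := by
    have hdm := Int.emod_add_mul_ediv (β * c - γ * b) r
    refine ⟨(β * c - γ * b) % r, α * c + γ * a + s * ((β * c - γ * b) / r),
      β * a + α * b - t * ((β * c - γ * b) / r), Int.emod_nonneg _ hrZ.ne',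
      Int.emod_lt_of_pos _ hrZ, ?_, ?_⟩
    · linear_combination s * hdm + c * hbez + γ * hstZ
    · linear_combination (-t : ℤ) * hdm + b * hbez + β * hstZ
  have e3 : s * w + t * v = a := by
    apply mul_left_cancel₀ hrZ.ne'
    linear_combination t * e1 + s * e2 - hstZ
  have e4 : u * a + v * b = w * c := by
    apply mul_left_cancel₀ hrZ.ne'
    linear_combination u * hstZ + b * e1 - c * e2
  have hbZ : (0 : ℤ) < b := by exact_mod_cast hb
  have hcZ : (0 : ℤ) < c := by exact_mod_cast hc
  have haZ : (0 : ℤ) < a := by exact_mod_cast ha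
  have hw : 0 < w := by
    have : 0 < (r : ℤ) * w := by rw [e2]; positivity
    exact pos_of_mul_pos_right this hrZ.le
  lift u to ℕ using hu0
  lift w to ℕ using hw.le
  have hv : 0 ≤ v := by
    by_contra hv
    obtain ⟨v', hv'⟩ := Int.eq_ofNat_of_zero_le (show 0 ≤ -v by omega)
    have hv2 : v = -v' := by omega
    subst hv2
    have h5 : u * a = v' * b + w * c := by
      zify; linarith
    have hu : 0 < u := by
      rcases Nat.eq_zero_or_pos u with h | h
      · subst h
        have : 0 < w * c := Nat.mul_pos (by exact_mod_cast hw) hc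
        omega
      · exact h
    have := hmin u v' w hu h5
    omega
  lift v to ℕ using hv
  norm_cast at *
  refine ⟨r, s, t, u, v, w, hr, hst, e1, e2, e3, fun i hi => ?_⟩
  have hQ : u + i ≤ r + u * i / r := by
    have : u + i - r ≤ u * i / r := by
      rw [Nat.le_div_iff_mul_le hr]
      rcases Nat.le_total (u + i) r with h | h
      · simp [Nat.sub_eq_zero_of_le h]
      · zify [h]
        have h1 : (i : ℤ) ≤ r := by exact_mod_cast hi
        have h2 : (u : ℤ) ≤ r := by exact_mod_cast hur.le
        nlinarith [mul_nonneg (sub_nonneg.2 h1) (sub_nonneg.2 h2)]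
    omega
  rcases Nat.eq_zero_or_pos u with hu | hu
  · subst hu
    simp at e2 ⊢
    rw [← e2, mul_comm r]
    exact Nat.mul_le_mul_left _ hi
  · have hwt : t ≤ w := by
      by_contra hlt
      push Not at hlt
      have := hmin (r - u) (s + v) (t - w) (by omega) (by
        zify [hur.le, hlt.le]
        zify at e4 hst
        linear_combination hst - e4)
      omega
    generalize u * i / r = Q at *
    obtain ⟨j, rfl⟩ := Nat.exists_eq_add_of_le hi
    have h1 : u ≤ Q + j := by omega
    have h2 : t * u ≤ t * Q + t * j := by rw [← mul_add]; exact Nat.mul_le_mul_left _ h1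
    have h3 : t * j ≤ w * j := Nat.mul_le_mul_right _ hwt
    have h4 : (i + j) * w = w * i + w * j := by ring
    omega

/-- The second polynomial, evaluated in a commutative ring. -/
def mcG {K : Type*} [CommRing K] (b r s t u v w : ℕ) (x y z : K) : K :=
  ∑ i ∈ Finset.range (r + 1), (-1) ^ i * (r.choose i : K) *
    (x ^ (u * i % r) * y ^ (v * i + s * (u * i / r)) * z ^ (b + t * (u * i / r) - w * i))

theorem mcG_map {K L : Type*} [CommRing K] [CommRing L] (φ : K →+* L) (b r s t u v w : ℕ)
    (x y z : K) : φ (mcG b r s t u v w x y z) = mcG b r s t u v w (φ x) (φ y) (φ z) := by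
  simp [mcG, map_sum]

theorem mcG_mul {K : Type*} [CommRing K] {b r s t u v w : ℕ}
    (hq : ∀ i ≤ r, w * i ≤ b + t * (u * i / r)) (x y z : K) (hf : x ^ r = y ^ s * z ^ t) :
    mcG b r s t u v w x y z * (z ^ w) ^ r = z ^ b * (z ^ w - x ^ u * y ^ v) ^ r := by
  rw [sub_eq_neg_add, add_pow, mcG, Finset.sum_mul, Finset.mul_sum]
  refine Finset.sum_congr rfl fun i hi => ?_
  have hi : i ≤ r := by simpa [Nat.lt_succ_iff] using hi
  have h1 := hq i hi
  have h2 := Nat.mod_add_div (u * i) r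
  have key : (x ^ (u * i % r) * y ^ (v * i + s * (u * i / r)) *
      z ^ (b + t * (u * i / r) - w * i)) * z ^ (w * i) = z ^ b * (x ^ u * y ^ v) ^ i := by
    rw [mul_assoc, ← pow_add, Nat.sub_add_cancel h1, mul_pow, ← pow_mul x, ← pow_mul y]
    conv_rhs => rw [← h2, pow_add x, pow_mul x, hf]
    ring
  obtain ⟨j, rfl⟩ := Nat.exists_eq_add_of_le hi
  rw [neg_pow, Nat.add_sub_cancel_left, pow_add (z ^ w), ← pow_mul z w i]
  linear_combination (-1) ^ i * ((i + j).choose i : K) * (z ^ w) ^ j * key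

theorem mc_points {K : Type*} [Field K] {a b c r s t u v w : ℕ} (ha : 0 < a) (hb : 0 < b)
    (hc : 0 < c) (hgcd : Nat.gcd a (Nat.gcd b c) = 1) (hr : 0 < r)
    (e0 : r * a = s * b + t * c) (e1 : r * v + s * u = c) (e2 : r * w = b + t * u)
    (e3 : s * w + t * v = a) (hq : ∀ i ≤ r, w * i ≤ b + t * (u * i / r))
    (x y z : K) (hf : x ^ r = y ^ s * z ^ t) (hg : mcG b r s t u v w x y z = 0) :
    ∃ T : K, x = T ^ a ∧ y = T ^ b ∧ z = T ^ c := by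
  -- exponent identities
  have hp : ∀ i, r * (v * i + s * (u * i / r)) + s * (u * i % r) = c * i := by
    intro i
    have h2 := Nat.mod_add_div (u * i) r
    rw [← e1]
    calc _ = r * v * i + s * (u * i % r + r * (u * i / r)) := by ring
      _ = _ := by rw [h2]; ring
  have hqq : ∀ i ≤ r, r * (b + t * (u * i / r) - w * i) + t * (u * i % r) = b * (r - i) := by
    intro i hi
    have h2 := Nat.mod_add_div (u * i) r
    have h1 := hq i hi
    zify [hi, h1] at *
    linear_combination t * h2 - i * e2
  have hst : 0 < s ∨ 0 < t := by
    by_contra h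
    push Not at h
    have h1 : s = 0 := by omega
    have h2 : t = 0 := by omega
    subst h1 h2
    simp at e3; omega
  have hy0 : y = 0 → x = 0 ∧ z = 0 := by
    intro hy
    have hz : z = 0 := by
      have : mcG b r s t u v w x y z = z ^ b := by
        rw [mcG, Finset.sum_eq_single 0]
        · simp
        · intro i hi hi0
          have hci : 0 < c * i := Nat.mul_pos hc (by omega)
          have h := hp i
          by_cases hp0 : v * i + s * (u * i / r) = 0
          · rw [hp0] at h
            have hse : 0 < s * (u * i % r) := by omega
            have hs : s ≠ 0 := by rintro rfl; simp at hse
            have he : u * i % r ≠ 0 := by intro h; simp [h] at hse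
            have hx : x = 0 := by
              rw [hy, zero_pow hs, zero_mul] at hf
              exact eq_zero_of_pow_eq_zero hf
            rw [hx, zero_pow he]; ring
          · rw [hy, zero_pow hp0]; ring
        · simp
      rw [this] at hg
      exact eq_zero_of_pow_eq_zero hg
    refine ⟨?_, hz⟩
    rcases hst with h | h
    · rw [hy, zero_pow h.ne', zero_mul] at hf
      exact eq_zero_of_pow_eq_zero hf
    · rw [hz, zero_pow h.ne', mul_zero] at hf
      exact eq_zero_of_pow_eq_zero hf
  have hz0 : z = 0 → x = 0 ∧ y = 0 := by
    intro hz
    have hy : y = 0 := by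
      have : mcG b r s t u v w x y z = (-1) ^ r * y ^ c := by
        rw [mcG, Finset.sum_eq_single r]
        · have h := hp r
          have h' := hqq r le_rfl
          rw [Nat.mul_mod_left, mul_zero, add_zero] at h h'
          have h3 : v * r + s * (u * r / r) = c := by
            apply Nat.eq_of_mul_eq_mul_left hr; rw [h, mul_comm]
          have h4 : b + t * (u * r / r) - w * r = 0 := by
            apply Nat.eq_of_mul_eq_mul_left hr; rw [h']; simp
          rw [h3, h4, Nat.mul_mod_left]
          simp
        · intro i hi hi0
          have hi : i ≤ r := by simpa [Nat.lt_succ_iff] using hi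
          have hci : 0 < b * (r - i) := Nat.mul_pos hb (by omega)
          have h := hqq i hi
          by_cases hp0 : b + t * (u * i / r) - w * i = 0
          · rw [hp0] at h
            have hse : 0 < t * (u * i % r) := by omega
            have ht : t ≠ 0 := by rintro rfl; simp at hse
            have he : u * i % r ≠ 0 := by intro h; simp [h] at hse
            have hx : x = 0 := by
              rw [hz, zero_pow ht, mul_zero] at hf
              exact eq_zero_of_pow_eq_zero hf
            rw [hx, zero_pow he]; ring
          · rw [hz, zero_pow hp0]; ring
        · simp
      rw [this] at hg
      rcases mul_eq_zero.1 hg with h | h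
      · exact absurd h (pow_ne_zero _ (by simp))
      · exact eq_zero_of_pow_eq_zero h
    exact ⟨(hy0 hy).1, hy⟩
  have hx0 : x = 0 → y = 0 ∧ z = 0 := by
    intro hx
    rw [hx, zero_pow hr.ne'] at hf
    rcases mul_eq_zero.1 hf.symm with h | h
    · have h := eq_zero_of_pow_eq_zero h
      exact ⟨h, (hy0 h).2⟩
    · have h := eq_zero_of_pow_eq_zero h
      exact ⟨(hz0 h).2, h⟩
  by_cases hx : x = 0
  · obtain ⟨hy, hz⟩ := hx0 hx
    exact ⟨0, by simp [hx, ha.ne'], by simp [hy, hb.ne'], by simp [hz, hc.ne']⟩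
  have hy : y ≠ 0 := fun h => hx (hy0 h).1
  have hz : z ≠ 0 := fun h => hx (hz0 h).1
  have hτ : z ^ w = x ^ u * y ^ v := by
    have h := mcG_mul (s := s) (v := v) hq x y z hf
    rw [hg, zero_mul] at h
    rcases mul_eq_zero.1 h.symm with h | h
    · exact absurd h (pow_ne_zero _ hz)
    · exact sub_eq_zero.1 (eq_zero_of_pow_eq_zero h)
  have r1 : x ^ b = y ^ a := by
    apply mul_right_cancel₀ (pow_ne_zero (t * u) hx)
    rw [← pow_add, ← e2, pow_mul, hf, mul_pow, ← pow_mul, ← pow_mul z, mul_comm t w, pow_mul z, hτ,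
      ← e3]
    ring
  have r2 : y ^ c = z ^ b := by
    apply mul_right_cancel₀ (pow_ne_zero (t * u) hz)
    rw [← pow_add z, ← e2, mul_comm r w, pow_mul z w, hτ, mul_pow, ← pow_mul x, mul_comm u r,
      pow_mul x, hf, ← e1]
    ring
  have r3 : x ^ c = z ^ a := by
    rw [← e1, ← e3, pow_add, pow_mul, hf, pow_add z, mul_comm s w, pow_mul z w, hτ]
    ring
  obtain ⟨i, j, l, hbez⟩ : ∃ i j l : ℤ, a * i + b * j + c * l = 1 := by
    have h1 := Nat.gcd_eq_gcd_ab a (Nat.gcd b c)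
    have h2 := Nat.gcd_eq_gcd_ab b c
    rw [hgcd] at h1
    refine ⟨Nat.gcdA a (Nat.gcd b c), Nat.gcdB a (Nat.gcd b c) * Nat.gcdA b c,
      Nat.gcdB a (Nat.gcd b c) * Nat.gcdB b c, ?_⟩
    rw [h2] at h1
    push_cast at h1
    linear_combination -h1
  have hcomm : ∀ (q : K) (m : ℤ) (n : ℕ), (q ^ m) ^ n = (q ^ n) ^ m := by
    intro q m n
    rw [← zpow_natCast, ← zpow_natCast, ← zpow_mul, ← zpow_mul, mul_comm]
  have hfin : ∀ q : K, q ≠ 0 → (q ^ a) ^ i * (q ^ b) ^ j * (q ^ c) ^ l = q := by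
    intro q hq
    rw [← zpow_natCast, ← zpow_natCast, ← zpow_natCast, ← zpow_mul, ← zpow_mul, ← zpow_mul,
      ← zpow_add₀ hq, ← zpow_add₀ hq, hbez, zpow_one]
  refine ⟨x ^ i * y ^ j * z ^ l, ?_, ?_, ?_⟩
  · rw [mul_pow, mul_pow, hcomm, hcomm, hcomm, ← r1, ← r3, hfin x hx]
  · rw [mul_pow, mul_pow, hcomm, hcomm, hcomm, r1, ← r2, hfin y hy]
  · rw [mul_pow, mul_pow, hcomm, hcomm, hcomm, r3, r2, hfin z hz]

/-- **Herzog; Bresinsky (1979).** Every monomial curve in `𝔸³` is a set-theoretic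
complete intersection. -/
theorem monomial_curve_A3_stci (k : Type*) [Field k] (a : Fin 3 → ℕ)
    (hpos : ∀ i, 0 < a i) (hgcd : Nat.gcd (a 0) (Nat.gcd (a 1) (a 2)) = 1) :
    ∃ f g : MvPolynomial (Fin 3) k,
      f ∈ monomialCurveIdeal k a ∧ g ∈ monomialCurveIdeal k a ∧
      (Ideal.span {f, g}).radical = monomialCurveIdeal k a := by
  obtain ⟨r, s, t, u, v, w, hr, e0, e1, e2, e3, hq⟩ :=
    mc_arith (a 0) (a 1) (a 2) (hpos 0) (hpos 1) (hpos 2)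
  have e4 : u * a 0 + v * a 1 = w * a 2 := by
    apply Nat.eq_of_mul_eq_mul_left hr
    zify at *
    linear_combination u * e0 + (a 1 : ℤ) * e1 - (a 2 : ℤ) * e2
  let f : MvPolynomial (Fin 3) k :=
    MvPolynomial.X 0 ^ r - MvPolynomial.X 1 ^ s * MvPolynomial.X 2 ^ t
  let g : MvPolynomial (Fin 3) k :=
    mcG (a 1) r s t u v w (MvPolynomial.X 0) (MvPolynomial.X 1) (MvPolynomial.X 2)
  have hfp : f ∈ monomialCurveIdeal k a := by
    simp only [monomialCurveIdeal, RingHom.mem_ker, f, map_sub, map_mul, map_pow,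
      MvPolynomial.aeval_X]
    rw [← pow_mul, ← pow_mul, ← pow_mul, ← pow_add, sub_eq_zero]
    congr 1
    linarith
  have hgp : g ∈ monomialCurveIdeal k a := by
    have hm := mcG_map ((MvPolynomial.aeval (R := k) fun i =>
      (Polynomial.X : Polynomial k) ^ a i : MvPolynomial (Fin 3) k →ₐ[k] Polynomial k) :
      MvPolynomial (Fin 3) k →+* Polynomial k) (a 1) r s t u v w
      (MvPolynomial.X 0) (MvPolynomial.X 1) (MvPolynomial.X 2)
    simp only [RingHom.coe_coe, MvPolynomial.aeval_X] at hm
    simp only [monomialCurveIdeal, RingHom.mem_ker, g]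
    refine hm.trans ?_
    have h := mcG_mul (s := s) (v := v) hq ((Polynomial.X : Polynomial k) ^ a 0) (Polynomial.X ^ a 1)
      (Polynomial.X ^ a 2) (by
        rw [← pow_mul, ← pow_mul, ← pow_mul, ← pow_add]
        congr 1
        linarith)
    have h0 : ((Polynomial.X : Polynomial k) ^ a 2) ^ w -
        (Polynomial.X ^ a 0) ^ u * (Polynomial.X ^ a 1) ^ v = 0 := by
      rw [← pow_mul, ← pow_mul, ← pow_mul, ← pow_add, sub_eq_zero]
      congr 1
      linarith
    rw [h0, zero_pow hr.ne', mul_zero] at h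
    exact (mul_eq_zero.1 h).resolve_right
      (pow_ne_zero _ (pow_ne_zero _ (pow_ne_zero _ Polynomial.X_ne_zero)))
  refine ⟨f, g, hfp, hgp, le_antisymm ?_ ?_⟩
  · have hprime : (monomialCurveIdeal k a).IsPrime := RingHom.ker_isPrime _
    rw [hprime.radical_le_iff, Ideal.span_le]
    rintro q (rfl | rfl)
    · exact hfp
    · exact hgp
  · rw [Ideal.radical_eq_sInf]
    refine le_sInf ?_
    rintro P ⟨hP, hprime⟩ F hF
    have hfP : f ∈ P := hP (Ideal.subset_span (by simp))
    have hgP : g ∈ P := hP (Ideal.subset_span (by simp))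
    let K := FractionRing (MvPolynomial (Fin 3) k ⧸ P)
    let ψ : MvPolynomial (Fin 3) k →ₐ[k] K :=
      (IsScalarTower.toAlgHom k (MvPolynomial (Fin 3) k ⧸ P) K).comp (Ideal.Quotient.mkₐ k P)
    have hψ : ∀ q, ψ q = 0 ↔ q ∈ P := by
      intro q
      have : ψ q = algebraMap (MvPolynomial (Fin 3) k ⧸ P) K (Ideal.Quotient.mk P q) := rfl
      rw [this, map_eq_zero_iff _ (IsFractionRing.injective (MvPolynomial (Fin 3) k ⧸ P) K),
        Ideal.Quotient.eq_zero_iff_mem]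
    have hf0 := (hψ f).2 hfP
    have hg0 := (hψ g).2 hgP
    obtain ⟨T, hx, hy, hz⟩ := mc_points (hpos 0) (hpos 1) (hpos 2) hgcd hr e0 e1 e2 e3 hq
      (ψ (MvPolynomial.X 0)) (ψ (MvPolynomial.X 1)) (ψ (MvPolynomial.X 2))
      (by simpa [f, sub_eq_zero] using hf0)
      (by
        have := mcG_map (ψ : MvPolynomial (Fin 3) k →+* K) (a 1) r s t u v w
          (MvPolynomial.X 0) (MvPolynomial.X 1) (MvPolynomial.X 2)
        exact this.symm.trans hg0)
    rw [← hψ]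
    have hcomp : ψ = (Polynomial.aeval T).comp
        (MvPolynomial.aeval (R := k) fun i => (Polynomial.X : Polynomial k) ^ a i) := by
      apply MvPolynomial.algHom_ext
      intro i
      fin_cases i
      · simpa using hx
      · simpa using hy
      · simpa using hz
    have hF0 : (MvPolynomial.aeval (R := k) fun i => (Polynomial.X : Polynomial k) ^ a i) F = 0 :=
      hF
    rw [hcomp, AlgHom.comp_apply, hF0, map_zero]
end

section
/- Let k be a field, S = k[X_0,…,X_d], and let I be a nonzero proper radical ideal of S. Let h be the largest height of a minimal prime of I. Then for every n ≥ 1, the symbolic power I^{(hn)} is contained in the ordinary power I^n. -/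
/-- The `n`-th symbolic power of an ideal `I`: the intersection, over the minimal primes
`q` of `I`, of the contractions of `I^n R_q` along the localization maps `R → R_q`
(an element lies in the contraction of `I^n R_q` iff it is multiplied into `I^n` by
some element outside `q`). -/
noncomputable def symbolicPower {R : Type*} [CommRing R] (I : Ideal R) (n : ℕ) : Ideal R where
  carrier := {x | ∀ q ∈ I.minimalPrimes, ∃ s ∉ q, s * x ∈ I ^ n}
  zero_mem' := by
    intro q hq
    exact ⟨1, fun h => hq.1.1.ne_top ((Ideal.eq_top_iff_one q).2 h), by
      simp⟩
  add_mem' := by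
    intro x y hx hy q hq
    obtain ⟨s, hs, hsx⟩ := hx q hq
    obtain ⟨t, ht, hty⟩ := hy q hq
    refine ⟨s * t, fun h => (hq.1.1.mem_or_mem h).elim hs ht, ?_⟩
    have h1 : s * t * (x + y) = t * (s * x) + s * (t * y) := by ring
    rw [h1]
    exact Ideal.add_mem _ (Ideal.mul_mem_left _ _ hsx) (Ideal.mul_mem_left _ _ hty)
  smul_mem' := by
    intro c x hx q hq
    obtain ⟨s, hs, hsx⟩ := hx q hq
    refine ⟨s, hs, ?_⟩
    have h1 : s * (c • x) = c * (s * x) := by rw [smul_eq_mul]; ring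
    rw [h1]
    exact Ideal.mul_mem_left _ _ hsx

theorem mem_symbolicPower_iff {R : Type*} [CommRing R] (I : Ideal R) (n : ℕ) (x : R) :
    x ∈ symbolicPower I n ↔ ∀ q ∈ I.minimalPrimes, ∃ s ∉ q, s * x ∈ I ^ n :=
  Iff.rfl

theorem symbolicPower_mul_mem {R : Type*} [CommRing R] (I : Ideal R) {i j : ℕ} {x y : R}
    (hx : x ∈ symbolicPower I i) (hy : y ∈ symbolicPower I j) :
    x * y ∈ symbolicPower I (i + j) := by
  intro q hq
  obtain ⟨s, hs, hsx⟩ := hx q hq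
  obtain ⟨t, ht, hty⟩ := hy q hq
  refine ⟨s * t, fun h => (hq.1.1.mem_or_mem h).elim hs ht, ?_⟩
  have h1 : s * t * (x * y) = (s * x) * (t * y) := by ring
  rw [h1, pow_add]
  exact Ideal.mul_mem_mul hsx hty

theorem mem_symbolicPower_zero {R : Type*} [CommRing R] (I : Ideal R) (x : R) :
    x ∈ symbolicPower I 0 := by
  intro q hq
  exact ⟨1, fun h => hq.1.1.ne_top ((Ideal.eq_top_iff_one q).2 h), by simp [Ideal.one_eq_top]⟩

/-- The height of an ideal: the infimum of the heights (in the prime spectrum,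
ordered by inclusion) of the primes containing it. -/
noncomputable def idealHeight {R : Type*} [CommRing R] (I : Ideal R) : ℕ∞ :=
  ⨅ (p : PrimeSpectrum R) (_ : I ≤ p.asIdeal), Order.height p


theorem reg_aux {R : Type*} [CommRing R] [IsRegularRing R] (P : Ideal R) [hPp : P.IsPrime] (h : ℕ)
    (hP : P.height ≤ h) : ∃ g : Fin h → R, (∀ l, g l ∈ P) ∧ ∃ r ∉ P, ∀ f ∈ P,
      r * f ∈ Ideal.span (Set.range g) := by
  classical
  let L := Localization.AtPrime P
  have hreg : IsRegularLocalRing L := inferInstance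
  have h1 := hreg.spanFinrank_maximalIdeal
  rw [IsLocalization.AtPrime.ringKrullDim_eq_height P L] at h1
  have h2 : (IsLocalRing.maximalIdeal L).spanFinrank ≤ h := by
    have : ((IsLocalRing.maximalIdeal L).spanFinrank : WithBot ℕ∞) ≤ (h : ℕ∞) := by
      rw [h1]; exact_mod_cast hP
    exact_mod_cast this
  have hfg : (IsLocalRing.maximalIdeal L).FG := Ideal.fg_of_isNoetherianRing _
  rw [← Submodule.FG.generators_ncard hfg] at h2
  have hfin := Submodule.FG.finite_generators hfg
  set G := (IsLocalRing.maximalIdeal L).generators with hG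
  have hspan : Ideal.span G = IsLocalRing.maximalIdeal L := Submodule.span_generators _
  obtain ⟨g', hg'1, hg'2⟩ : ∃ g' : Fin h → L, (∀ l, g' l ∈ IsLocalRing.maximalIdeal L) ∧
      G ⊆ Set.range g' := by
    lift G to Finset L using hfin with T
    rw [Set.ncard_coe_finset] at h2
    let e := T.equivFin
    refine ⟨fun l => if hl : l.1 < T.card then (e.symm ⟨l, hl⟩ : L) else 0, ?_, ?_⟩
    · intro l
      dsimp only
      split_ifs with hl
      · rw [← hspan]
        exact Ideal.subset_span (e.symm ⟨l, hl⟩).2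
      · exact zero_mem _
    · intro x hx
      refine ⟨⟨(e ⟨x, hx⟩).1, lt_of_lt_of_le (e ⟨x, hx⟩).2 h2⟩, ?_⟩
      simp
  have h3 : ∀ l, ∃ a : R, a ∈ P ∧ ∃ s : P.primeCompl, g' l * algebraMap R L s = algebraMap R L a := by
    intro l
    obtain ⟨⟨a, s⟩, hs⟩ := IsLocalization.surj P.primeCompl (g' l)
    refine ⟨a, ?_, s, hs⟩
    have : algebraMap R L a ∈ IsLocalRing.maximalIdeal L := by
      rw [← hs]; exact Ideal.mul_mem_right _ _ (hg'1 l)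
    exact (IsLocalization.AtPrime.to_map_mem_maximal_iff L P a).1 this
  choose g hgP s hgs using h3
  refine ⟨g, hgP, ?_⟩
  have h4 : ∀ f ∈ P, ∃ r ∉ P, r * f ∈ Ideal.span (Set.range g) := by
    intro f hf
    have h5 : IsLocalRing.maximalIdeal L ≤ (Ideal.span (Set.range g)).map (algebraMap R L) := by
      rw [← hspan, Ideal.span_le]
      intro x hx
      obtain ⟨l, rfl⟩ := hg'2 hx
      have hu : IsUnit (algebraMap R L (s l)) := IsLocalization.map_units L (s l)
      refine (Ideal.mul_unit_mem_iff_mem _ hu).1 ?_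
      rw [hgs]
      exact Ideal.mem_map_of_mem _ (Ideal.subset_span ⟨l, rfl⟩)
    have h6 := h5 ((IsLocalization.AtPrime.to_map_mem_maximal_iff L P f).2 hf)
    rw [IsLocalization.algebraMap_mem_map_algebraMap_iff P.primeCompl] at h6
    obtain ⟨m, hm, hmf⟩ := h6
    exact ⟨m, hm, hmf⟩
  obtain ⟨T, hT⟩ : P.FG := Ideal.fg_of_isNoetherianRing _
  have h7 : ∀ f : T, ∃ r : R, r ∉ P ∧ r * (f : R) ∈ Ideal.span (Set.range g) := fun f =>
    h4 f (hT ▸ Ideal.subset_span f.2)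
  choose r hr hrf using h7
  refine ⟨∏ f : T, r f, ?_, ?_⟩
  · intro hmem
    obtain ⟨f, -, hf⟩ := (hPp.prod_mem_iff).1 hmem
    exact hr f hf
  · have : P ≤ Submodule.comap
        (LinearMap.mulLeft R (∏ f : T, r f) : R →ₗ[R] R) (Ideal.span (Set.range g)) := by
      conv_lhs => rw [← hT]
      refine Submodule.span_le.2 ?_
      intro f hf
      change (∏ f : T, r f) * f ∈ Ideal.span (Set.range g)
      obtain ⟨c, hc⟩ := Finset.dvd_prod_of_mem r (Finset.mem_univ (⟨f, hf⟩ : T))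
      rw [hc, mul_right_comm]
      exact Ideal.mul_mem_right _ _ (hrf _)
    intro f hf
    exact this hf

/-- Colon property of a ring homomorphism (a consequence of flatness). -/
def ColonProp {R S : Type*} [CommRing R] [CommRing S] (F : R →+* S) : Prop :=
  ∀ (I J : Ideal R) (d : R), (∀ x, d * x ∈ I → x ∈ J) → ∀ s, F d * s ∈ I.map F → s ∈ J.map F

theorem ColonProp.comp {R S T : Type*} [CommRing R] [CommRing S] [CommRing T] {F : R →+* S}
    {G : S →+* T} (hG : ColonProp G) (hF : ColonProp F) : ColonProp (G.comp F) := by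
  intro I J d h s hs
  rw [← Ideal.map_map] at hs ⊢
  exact hG _ _ (F d) (fun x hx => hF I J d h x hx) s hs

theorem colonProp_of_dual {R S : Type*} [CommRing R] [CommRing S] (F : R →+* S) {ι : Type*}
    (co : ι → S →+ R) (h1 : ∀ i r s, co i (F r * s) = r * co i s)
    (h2 : ∀ s, s ∈ Ideal.span (Set.range fun i => F (co i s))) : ColonProp F := by
  intro I J d h s hs
  have key : ∀ (t : S), t ∈ I.map F → ∀ i, co i t ∈ I := by
    intro t ht i
    have : ∀ a : S, co i (a * t) ∈ I := by
      refine Submodule.span_induction (p := fun t _ => ∀ a : S, co i (a * t) ∈ I)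
        ?_ ?_ ?_ ?_ ht
      · rintro _ ⟨x, hx, rfl⟩ a
        rw [mul_comm, h1]
        exact Ideal.mul_mem_right _ _ hx
      · intro a; simp
      · intro x y _ _ hx hy a
        rw [mul_add, map_add]
        exact add_mem (hx a) (hy a)
      · intro b x _ hx a
        rw [smul_eq_mul, ← mul_assoc]
        exact hx _
    simpa using this 1
  have h3 : ∀ i, co i s ∈ J := fun i => h _ (by rw [← h1]; exact key _ hs i)
  refine Ideal.span_le.2 ?_ (h2 s)
  rintro _ ⟨i, rfl⟩
  exact Ideal.mem_map_of_mem _ (h3 i)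

open MvPolynomial in
theorem colonProp_expand {σ k : Type*} [Fintype σ] [CommRing k] (p : ℕ) [NeZero p] :
    ColonProp (expand p : MvPolynomial σ k →ₐ[k] MvPolynomial σ k).toRingHom := by
  classical
  let co : (σ → ZMod p) → MvPolynomial σ k →ₗ[k] MvPolynomial σ k := fun a =>
    (basisMonomials σ k).constr k fun b =>
      if (fun i => (b i : ZMod p)) = a then monomial (b.mapRange (· / p) (Nat.zero_div p)) 1 else 0
  have hco : ∀ a b c, co a (monomial b c) =
      if (fun i => (b i : ZMod p)) = a then monomial (b.mapRange (· / p) (Nat.zero_div p)) c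
        else 0 := by
    intro a b c
    have h0 : (monomial b c : MvPolynomial σ k) = c • basisMonomials σ k b := by
      simp [smul_monomial]
    rw [h0, map_smul, Module.Basis.constr_basis]
    split_ifs <;> simp [smul_monomial]
  have hp : 0 < p := Nat.pos_of_ne_zero (NeZero.ne p)
  refine colonProp_of_dual _ (fun a => (co a).toAddMonoidHom) ?_ ?_
  · intro a r s
    change co a (expand p r * s) = r * co a s
    induction r using MvPolynomial.induction_on' with
    | add r r' hr hr' => rw [map_add, add_mul, map_add, hr, hr', add_mul]
    | monomial b c =>
      induction s using MvPolynomial.induction_on' with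
      | add r r' hr hr' => rw [mul_add, map_add, hr, hr', map_add, mul_add]
      | monomial b' c' =>
        rw [expand_monomial, monomial_mul, hco, hco]
        have e1 : (fun i => (((p • b + b') i : ℕ) : ZMod p)) = fun i => ((b' i : ℕ) : ZMod p) := by
          funext i; simp
        have e2 : (p • b + b').mapRange (· / p) (Nat.zero_div p) =
            b + b'.mapRange (· / p) (Nat.zero_div p) := by
          ext i
          simp [Nat.mul_add_div hp]
        rw [e1, e2]
        split_ifs
        · rw [monomial_mul]
        · simp
  · intro s
    have hs : s = ∑ a : σ → ZMod p, expand p (co a s) *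
        monomial (Finsupp.equivFunOnFinite.symm fun i => (a i).val) 1 := by
      induction s using MvPolynomial.induction_on' with
      | add r r' hr hr' =>
        conv_lhs => rw [hr, hr']
        simp only [map_add, add_mul, Finset.sum_add_distrib]
      | monomial b c =>
        simp only [hco]
        rw [Finset.sum_eq_single (fun i => (b i : ZMod p))]
        · rw [if_pos rfl, expand_monomial, monomial_mul, mul_one]
          congr 2
          ext i
          simp [ZMod.val_natCast, Nat.div_add_mod]
        · intro a _ ha
          rw [if_neg (Ne.symm ha)]
          simp
        · simp
    have hmem : ∑ a : σ → ZMod p, expand p (co a s) *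
        monomial (Finsupp.equivFunOnFinite.symm fun i => (a i).val) 1 ∈
        Ideal.span (Set.range fun a => expand p (co a s)) :=
      Submodule.sum_mem _ fun a _ => Ideal.mul_mem_right _ _
        (Ideal.subset_span (Set.mem_range_self a))
    rw [← hs] at hmem
    exact hmem

open MvPolynomial in
theorem colonProp_map {σ k K : Type*} [Field k] [Field K] (φ : k →+* K) :
    ColonProp (map φ : MvPolynomial σ k →+* MvPolynomial σ K) := by
  classical
  let _ : Algebra k K := φ.toAlgebra
  let B := Module.Basis.ofVectorSpace k K
  let co : Module.Basis.ofVectorSpaceIndex k K → MvPolynomial σ K →+ MvPolynomial σ k := fun i =>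
    { toFun := fun s => AddMonoidAlgebra.ofCoeff (Finsupp.mapRange (B.coord i) (map_zero _) (AddMonoidAlgebra.coeff s))
      map_zero' := by ext m; simp [MvPolynomial.coeff]
      map_add' := fun s t => by ext m; simp [MvPolynomial.coeff] }
  have hco : ∀ i s m, (co i s).coeff m = B.coord i (s.coeff m) := fun i s m => rfl
  refine colonProp_of_dual _ co ?_ ?_
  · intro i r s
    ext m
    change (co i (map φ r * s)).coeff m = (r * co i s).coeff m
    rw [hco]
    change B.coord i (MvPolynomial.coeff m (map φ r * s)) = MvPolynomial.coeff m (r * co i s)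
    rw [coeff_mul, coeff_mul, map_sum]
    refine Finset.sum_congr rfl fun x _ => ?_
    rw [coeff_map]
    change B.coord i (algebraMap k K _ * _) = _ * B.coord i (MvPolynomial.coeff x.2 s)
    rw [← Algebra.smul_def, map_smul, smul_eq_mul]
  · intro s
    let T := s.support.biUnion fun m => (B.repr (MvPolynomial.coeff m s)).support
    have hs : s = ∑ i ∈ T, C (B i) * map φ (co i s) := by
      ext m
      rw [coeff_sum]
      simp only [coeff_C_mul, coeff_map]
      have h1 := B.linearCombination_repr (MvPolynomial.coeff m s)
      rw [Finsupp.linearCombination_apply, Finsupp.sum_of_support_subset (s := T)] at h1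
      · conv_lhs => rw [← h1]
        refine Finset.sum_congr rfl fun i _ => ?_
        rw [Algebra.smul_def, mul_comm]
        rfl
      · intro i hi
        refine Finset.mem_biUnion.2 ⟨m, ?_, hi⟩
        rw [mem_support_iff]
        intro h0
        rw [h0] at hi
        simp at hi
      · simp
    have hmem : ∑ i ∈ T, C (B i) * map φ (co i s) ∈
        Ideal.span (Set.range fun i => map φ (co i s)) :=
      Submodule.sum_mem _ fun a _ => Ideal.mul_mem_left _ _
        (Ideal.subset_span (Set.mem_range_self a))
    rw [← hs] at hmem
    exact hmem

open MvPolynomial in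
theorem colonProp_frobenius {σ k : Type*} [Fintype σ] [Field k] (p : ℕ) [Fact p.Prime]
    [CharP k p] (e : ℕ) :
    ColonProp (iterateFrobenius (MvPolynomial σ k) p e) := by
  induction e with
  | zero =>
    intro I J d h s hs
    have h0 : iterateFrobenius (MvPolynomial σ k) p 0 = RingHom.id _ := by
      ext1 <;> simp
    rw [h0, Ideal.map_id] at hs ⊢
    exact h _ hs
  | succ e ih =>
    have h1 : iterateFrobenius (MvPolynomial σ k) p (e + 1) =
        ((map (frobenius k p)).comp (expand p).toRingHom).comp
          (iterateFrobenius (MvPolynomial σ k) p e) := by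
      refine RingHom.ext fun x => ?_
      change _ = map (frobenius k p) (expand p (iterateFrobenius _ p e x))
      rw [map_frobenius_expand]
      simp [iterateFrobenius_def, pow_succ, pow_mul]
    rw [h1]
    have : NeZero p := ⟨(Fact.out : p.Prime).ne_zero⟩
    exact ((colonProp_map _).comp (colonProp_expand p)).comp ih

theorem span_pow_le_aux {R ι : Type*} [CommRing R] (g : ι → R) (q : ℕ) (s : Finset ι) :
    (⨆ l ∈ s, Ideal.span {g l}) ^ (s.card * q + 1) ≤ ⨆ l ∈ s, Ideal.span {g l ^ q} := by
  classical
  induction s using Finset.induction_on with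
  | empty => simp
  | insert a s ha ih =>
    rw [Finset.card_insert_of_notMem ha, Finset.iSup_insert, Finset.iSup_insert]
    have : (s.card + 1) * q + 1 = q + (s.card * q + 1) := by ring
    rw [this]
    refine Ideal.sup_pow_add_le_pow_sup_pow.trans ?_
    rw [Ideal.span_singleton_pow]
    exact sup_le_sup_left ih _

/-- The characteristic `p` case, in terms of certificate data. -/
theorem charp_main {σ k : Type*} [Finite σ] [Field k] (p : ℕ) [Fact p.Prime] [CharP k p]
    (I : Ideal (MvPolynomial σ k)) (h n : ℕ) (hh : 1 ≤ h) (hn : 1 ≤ n) {ι : Type*} [Fintype ι]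
    (c : ι → MvPolynomial σ k) (g : ι → Fin h → MvPolynomial σ k) (u : MvPolynomial σ k)
    (hgI : ∀ j l, g j l ∈ I)
    (hcI : ∀ j, ∀ f ∈ I, c j * f ∈ Ideal.span (Set.range (g j)))
    (hcu : ∀ j, c j * u ∈ I ^ (h * n))
    (hD : ∀ y, (∑ j, c j ^ (h + 2)) * y ∈ I → y ∈ I) : u ∈ I ^ n := by
  classical
  cases nonempty_fintype σ
  by_cases hI : I = ⊥
  · subst hI
    have h0 : (⊥ : Ideal (MvPolynomial σ k)) ^ (h * n) = ⊥ :=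
      Ideal.bot_pow (Nat.mul_ne_zero (by omega) (by omega))
    have hu : u = 0 := by
      refine (Ideal.mem_bot).1 (hD u ?_)
      rw [Finset.sum_mul]
      refine sum_mem fun j _ => ?_
      have := hcu j
      rw [h0] at this
      rw [pow_succ, mul_assoc]
      exact Ideal.mul_mem_left _ _ this
    rw [hu]; exact zero_mem _
  by_contra hu
  set D := ∑ j, c j ^ (h + 2) with hDdef
  let Q : Ideal (MvPolynomial σ k) := Submodule.comap (LinearMap.mulLeft (MvPolynomial σ k) u) (I ^ n)
  have hQ : ∀ x, u * x ∈ I ^ n → x ∈ Q := fun x hx => hx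
  have hQtop : Q ≠ ⊤ := by
    intro h1
    have : (1 : MvPolynomial σ k) ∈ Q := h1 ▸ Submodule.mem_top
    have h2 : u * 1 ∈ I ^ n := this
    exact hu (by simpa using h2)
  obtain ⟨f, hfI, hf0⟩ := Submodule.exists_mem_ne_zero_of_ne_bot hI
  have hG0 : f ^ ((h * n + 1) * n) ≠ 0 := pow_ne_zero _ hf0
  have hGI : f ^ ((h * n + 1) * n) ∈ (I ^ (h * n + 1)) ^ n := by
    rw [← pow_mul]; exact Ideal.pow_mem_pow hfI _
  have main : ∀ e : ℕ, f ^ ((h * n + 1) * n) ∈ Q ^ e := by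
    intro e
    set F := iterateFrobenius (MvPolynomial σ k) p e with hF
    have hFx : ∀ x, F x = x ^ (p ^ e) := fun x => iterateFrobenius_def _ _ _
    have hcol : ColonProp F := colonProp_frobenius p e
    set q := p ^ e with hq
    have hq1 : 1 ≤ q := Nat.one_le_pow _ _ (Fact.out : p.Prime).pos
    have hqe : e ≤ q := (Nat.lt_pow_self (Fact.out : p.Prime).one_lt).le
    set a := q / n with ha
    have haq : a ≤ q := Nat.div_le_self _ _
    have hqa : q ≤ a * n + n := by
      have := Nat.div_add_mod q n
      have := Nat.mod_lt q (by omega : n > 0)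
      rw [mul_comm, ha]
      omega
    have han : a * n ≤ q := Nat.div_mul_le_self _ _
    -- step 1
    have step1 : ∀ y ∈ I ^ (h * n + 1), u ^ a * y ∈ I.map F := by
      intro y hy
      refine hcol I I D hD _ ?_
      rw [hDdef, map_sum, Finset.sum_mul]
      refine sum_mem fun j _ => ?_
      have h1 : (c j * u) ^ a * y ∈ I ^ (h * q + 1) := by
        have h2 : (c j * u) ^ a * y ∈ (I ^ (h * n)) ^ a * I ^ (h * n + 1) :=
          Ideal.mul_mem_mul (Ideal.pow_mem_pow (hcu j) _) hy
        rw [← pow_mul, ← pow_add] at h2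
        refine Ideal.pow_le_pow_right ?_ h2
        have := Nat.mul_le_mul_left h hqa
        nlinarith
      have h2 : c j ^ (h * q + 1) * ((c j * u) ^ a * y) ∈ I.map F := by
        have h3 : Ideal.span {c j} * I ≤ Ideal.span (Set.range (g j)) :=
          Ideal.span_singleton_mul_le_iff.2 (hcI j)
        have h4 : c j ^ (h * q + 1) * ((c j * u) ^ a * y) ∈
            Ideal.span {c j} ^ (h * q + 1) * I ^ (h * q + 1) :=
          Ideal.mul_mem_mul (Ideal.pow_mem_pow (Ideal.mem_span_singleton_self _) _) h1
        rw [← mul_pow] at h4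
        have h5 := Ideal.pow_right_mono h3 _ h4
        have h6 := span_pow_le_aux (g j) q Finset.univ
        simp only [Finset.mem_univ, iSup_pos, Finset.card_univ, Fintype.card_fin] at h6
        rw [← Ideal.span_iUnion, Set.iUnion_singleton_eq_range] at h6
        refine (iSup_le fun l => ?_ : (⨆ l, Ideal.span {g j l ^ q}) ≤ I.map F) (h6 h5)
        rw [Ideal.span_singleton_le_iff_mem, ← hFx]
        exact Ideal.mem_map_of_mem _ (hgI j l)
      have h3 : F (c j ^ (h + 2)) * (u ^ a * y) =
          c j ^ ((h + 2) * q - (h * q + 1 + a)) * (c j ^ (h * q + 1) * ((c j * u) ^ a * y)) := by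
        have h4 : (h + 2) * q = ((h + 2) * q - (h * q + 1 + a)) + (h * q + 1 + a) := by
          have : h * q + 1 + a ≤ (h + 2) * q := by nlinarith
          omega
        rw [hFx, ← pow_mul]
        conv_lhs => rw [h4]
        rw [pow_add, pow_add, pow_add, mul_pow]
        ring
      rw [h3]
      exact Ideal.mul_mem_left _ _ h2
    have step2 : Ideal.span {u ^ a} * I ^ (h * n + 1) ≤ I.map F :=
      Ideal.span_singleton_mul_le_iff.2 step1
    have step3 := Ideal.pow_right_mono step2 n
    rw [mul_pow, ← Ideal.map_pow, Ideal.span_singleton_pow, ← pow_mul] at step3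
    have step4 : F u * f ^ ((h * n + 1) * n) ∈ (I ^ n).map F := by
      have : F u = u ^ (q - a * n) * u ^ (a * n) := by
        rw [hFx, ← pow_add]
        congr 1; omega
      rw [this, mul_assoc]
      exact Ideal.mul_mem_left _ _
        (step3 (Ideal.mul_mem_mul (Ideal.mem_span_singleton_self _) hGI))
    have step5 := hcol (I ^ n) Q u hQ _ step4
    refine (Ideal.map_le_iff_le_comap.2 fun x hx => ?_ : Q.map F ≤ Q ^ e) step5
    rw [Ideal.mem_comap, hFx]
    exact Ideal.pow_le_pow_right hqe (Ideal.pow_mem_pow hx _)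
  have hbot := Ideal.iInf_pow_eq_bot_of_isDomain Q hQtop
  have : f ^ ((h * n + 1) * n) ∈ (⨅ i, Q ^ i) := by
    rw [Ideal.mem_iInf]; exact main
  rw [hbot] at this
  exact hG0 this

section Reduction

open MvPolynomial

/-- The comparison map from polynomials over a subring to polynomials over the field. -/
noncomputable abbrev psiMap {k : Type*} [Field k] (σ : Type*) (A : Subalgebra ℤ k) :
    MvPolynomial σ A →+* MvPolynomial σ k := map (algebraMap A k)

theorem psiMap_injective {k : Type*} [Field k] (σ : Type*) (A : Subalgebra ℤ k) :
    Function.Injective (psiMap σ A) := map_injective _ Subtype.val_injective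

theorem degree_psiMap {k : Type*} [Field k] {σ : Type*} (m : MonomialOrder σ) (A : Subalgebra ℤ k)
    (f : MvPolynomial σ A) : m.degree (psiMap σ A f) = m.degree f := by
  unfold MonomialOrder.degree
  rw [support_map_of_injective f (f := algebraMap A k) Subtype.val_injective]

theorem leadingCoeff_psiMap {k : Type*} [Field k] {σ : Type*} (m : MonomialOrder σ)
    (A : Subalgebra ℤ k) (f : MvPolynomial σ A) :
    m.leadingCoeff (psiMap σ A f) = algebraMap A k (m.leadingCoeff f) := by
  unfold MonomialOrder.leadingCoeff
  rw [degree_psiMap, coeff_map]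

/-- Groebner bases and uniform division. -/
theorem groebner_aux {k : Type*} [Field k] {N : ℕ} (J : Ideal (MvPolynomial (Fin N) k)) :
    ∃ G : Finset (MvPolynomial (Fin N) k), (∀ g ∈ G, g ∈ J) ∧ ∀ A : Subalgebra ℤ k,
      (∀ g ∈ G, ∃ g', psiMap (Fin N) A g' = g) →
      ∃ rem : MvPolynomial (Fin N) A →ₗ[A] MvPolynomial (Fin N) A,
        (∀ f, f - rem f ∈ Ideal.span {g' | psiMap (Fin N) A g' ∈ G}) ∧
        ∀ f, psiMap (Fin N) A f ∈ J → rem f = 0 := by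
  classical
  let m : MonomialOrder (Fin N) := MonomialOrder.lex
  let E : Set (Fin N →₀ ℕ) := {e | ∃ f ∈ J, m.leadingCoeff f = 1 ∧ m.degree f = e}
  obtain ⟨E0, hE0, hE0'⟩ : ∃ E0 : Finset (Fin N →₀ ℕ), (E0 : Set _) ⊆ E ∧
      ∀ e ∈ E, ∃ e0 ∈ E0, e0 ≤ e := by
    let mon : (Fin N →₀ ℕ) → MvPolynomial (Fin N) k := fun e => monomial e 1
    have hfg : (Ideal.span (mon '' E)).FG := Ideal.fg_of_isNoetherianRing _
    obtain ⟨S, hS, hS2⟩ := (Submodule.fg_span_iff_fg_span_finset_subset _).1 hfg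
    obtain ⟨E0, hE0, hE0S⟩ := (Finset.subset_set_image_iff).1 hS
    refine ⟨E0, hE0, fun e he => ?_⟩
    have h1 : mon e ∈ Ideal.span (mon '' (E0 : Set _)) := by
      have h2 : mon e ∈ Ideal.span (mon '' E) := Ideal.subset_span ⟨e, he, rfl⟩
      have h3 : Ideal.span (mon '' E) = Ideal.span (S : Set (MvPolynomial (Fin N) k)) := hS2
      rw [h3, ← hE0S, Finset.coe_image] at h2
      exact h2
    rw [mem_ideal_span_monomial_image] at h1
    exact h1 e (by simp [mon, mem_support_iff])
  have hE1 : ∀ e : E0, ∃ f ∈ J, m.leadingCoeff f = 1 ∧ m.degree f = e := fun e => hE0 e.2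
  choose b hbJ hblc hbdeg using hE1
  refine ⟨Finset.univ.image b, ?_, ?_⟩
  · intro g hg
    obtain ⟨e, -, rfl⟩ := Finset.mem_image.1 hg
    exact hbJ e
  intro A hA
  have hA' : ∀ e : E0, ∃ g', psiMap (Fin N) A g' = b e := fun e =>
    hA _ (Finset.mem_image_of_mem _ (Finset.mem_univ _))
  choose b' hb' using hA'
  have hlc : ∀ e, IsUnit (m.leadingCoeff (b' e)) := by
    intro e
    have : m.leadingCoeff (b' e) = 1 := by
      have h1 := leadingCoeff_psiMap m A (b' e)
      rw [hb', hblc] at h1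
      exact (Subtype.val_injective (by simpa using h1.symm))
    rw [this]; exact isUnit_one
  have hdeg : ∀ e, m.degree (b' e) = e := by
    intro e
    rw [← degree_psiMap, hb', hbdeg]
  -- standard polynomials in `J` vanish
  have huniq : ∀ r : MvPolynomial (Fin N) A, psiMap (Fin N) A r ∈ J →
      (∀ c ∈ r.support, ∀ e : E0, ¬ (e : Fin N →₀ ℕ) ≤ c) → r = 0 := by
    intro r hr hstd
    by_contra h0
    have h1 : psiMap (Fin N) A r ≠ 0 := fun h => h0 (psiMap_injective _ A (by rw [h, map_zero]))
    have hl : m.leadingCoeff (psiMap (Fin N) A r) ≠ 0 := m.leadingCoeff_ne_zero_iff.2 h1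
    have h2 : m.degree r ∈ E := by
      refine ⟨C (m.leadingCoeff (psiMap (Fin N) A r))⁻¹ * psiMap (Fin N) A r,
        Ideal.mul_mem_left _ _ hr, ?_, ?_⟩
      · rw [MonomialOrder.leadingCoeff_mul]
        simp [hl]
      · rw [MonomialOrder.degree_mul (by simpa using hl) h1, degree_psiMap]
        simp
    obtain ⟨e0, he0, hle⟩ := hE0' _ h2
    exact hstd _ (m.degree_mem_support h0) ⟨e0, he0⟩ hle
  have hdiv : ∀ f : MvPolynomial (Fin N) A, ∃ r : MvPolynomial (Fin N) A,
      f - r ∈ Ideal.span (Set.range b') ∧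
      (∀ c ∈ r.support, ∀ e : E0, ¬ (e : Fin N →₀ ℕ) ≤ c) := by
    intro f
    obtain ⟨g, r, h1, -, h3⟩ := m.div hlc f
    refine ⟨r, ?_, fun c hc e => by rw [← hdeg e]; exact h3 c hc e⟩
    have : f - r = Finsupp.linearCombination _ b' g := by rw [h1]; ring
    rw [this]
    exact (Finsupp.mem_span_range_iff_exists_finsupp).2 ⟨g, rfl⟩
  have hspanJ : Ideal.span (Set.range b') ≤ J.comap (psiMap (Fin N) A) := by
    rw [Ideal.span_le]
    rintro _ ⟨e, rfl⟩
    change psiMap (Fin N) A (b' e) ∈ J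
    rw [hb']; exact hbJ e
  choose rem hrem1 hrem2 using hdiv
  have huniq2 : ∀ f r : MvPolynomial (Fin N) A, f - r ∈ Ideal.span (Set.range b') →
      (∀ c ∈ r.support, ∀ e : E0, ¬ (e : Fin N →₀ ℕ) ≤ c) → rem f = r := by
    intro f r h1 h2
    rw [← sub_eq_zero]
    refine huniq _ (hspanJ ?_) ?_
    · have : rem f - r = (f - r) - (f - rem f) := by ring
      rw [this]
      exact sub_mem h1 (hrem1 f)
    · intro c hc e
      rcases Finset.mem_union.1 (support_sub (Fin N) _ _ hc) with h | h
      · exact hrem2 f c h e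
      · exact h2 c h e
  refine ⟨{ toFun := rem, map_add' := ?_, map_smul' := ?_ }, ?_, ?_⟩
  · intro f f'
    refine huniq2 _ _ ?_ ?_
    · have : f + f' - (rem f + rem f') = (f - rem f) + (f' - rem f') := by ring
      rw [this]
      exact add_mem (hrem1 f) (hrem1 f')
    · intro c hc e
      rcases Finset.mem_union.1 (support_add hc) with h | h
      · exact hrem2 f c h e
      · exact hrem2 f' c h e
  · intro a f
    refine huniq2 _ _ ?_ ?_
    · have : a • f - (RingHom.id A) a • rem f = C a * (f - rem f) := by
        rw [← smul_eq_C_mul, smul_sub]; rfl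
      rw [this]
      exact Ideal.mul_mem_left _ _ (hrem1 f)
    · intro c hc e
      exact hrem2 f c (support_smul hc) e
  · intro f
    refine Ideal.span_mono ?_ (hrem1 f)
    rintro _ ⟨e, rfl⟩
    change psiMap (Fin N) A (b' e) ∈ Finset.univ.image b
    rw [hb']
    exact Finset.mem_image_of_mem _ (Finset.mem_univ _)
  · intro f hf
    exact huniq2 f 0 (by
      have h1 : f = rem f + (f - rem f) := by ring
      have h2 : rem f = 0 := by
        refine huniq _ ?_ (hrem2 f)
        have : rem f = f - (f - rem f) := by ring
        rw [this, map_sub]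
        exact sub_mem hf (hspanJ (hrem1 f))
      have h3 := hrem1 f
      rwa [h2] at h3) (by simp)

/-- The subring generated by a finite set. -/
abbrev finAdj {k : Type*} [Field k] (T : Finset k) : Subalgebra ℤ k :=
  Algebra.adjoin ℤ (T : Set k)

open Filter

theorem ev_lift {k σ : Type*} [Field k] (f : MvPolynomial σ k) :
    ∀ᶠ T : Finset k in atTop, ∃ f', psiMap σ (finAdj T) f' = f := by
  classical
  filter_upwards [eventually_ge_atTop f.coeffs] with T hT
  have := (mem_range_map_iff_coeffs_subset (f := algebraMap (finAdj T) k) (x := f)).2 (by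
    intro c hc
    exact ⟨⟨c, Algebra.subset_adjoin (hT hc)⟩, rfl⟩)
  exact this

theorem ev_pow {k σ : Type*} [Field k] (I : Ideal (MvPolynomial σ k)) (m : ℕ)
    (f : MvPolynomial σ k) (hf : f ∈ I ^ m) :
    ∀ᶠ T : Finset k in atTop, ∃ f' ∈ (I.comap (psiMap σ (finAdj T))) ^ m,
      psiMap σ (finAdj T) f' = f := by
  induction m generalizing f with
  | zero =>
    filter_upwards [ev_lift f] with T ⟨f', hf'⟩
    exact ⟨f', by simp, hf'⟩
  | succ m ih =>
    rw [pow_succ] at hf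
    refine Submodule.mul_induction_on hf ?_ ?_
    · intro a ha b hb
      filter_upwards [ih a ha, ev_lift b] with T ⟨a', ha', haa⟩ ⟨b', hb'⟩
      refine ⟨a' * b', ?_, by rw [map_mul, haa, hb']⟩
      rw [pow_succ]
      refine Ideal.mul_mem_mul ha' ?_
      rw [Ideal.mem_comap, hb']
      exact hb
    · intro a b ha hb
      filter_upwards [ha, hb] with T ⟨a', ha', haa⟩ ⟨b', hb', hbb⟩
      exact ⟨a' + b', add_mem ha' hb', by rw [map_add, haa, hbb]⟩

theorem ev_span {k σ ι : Type*} [Field k] [Fintype ι] (g : ι → MvPolynomial σ k)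
    (f : MvPolynomial σ k) (hf : f ∈ Ideal.span (Set.range g)) :
    ∀ᶠ T : Finset k in atTop, ∀ g' : ι → MvPolynomial σ (finAdj T),
      (∀ i, psiMap σ (finAdj T) (g' i) = g i) → ∀ f', psiMap σ (finAdj T) f' = f →
      f' ∈ Ideal.span (Set.range g') := by
  obtain ⟨a, ha⟩ := (Ideal.mem_span_range_iff_exists_fun).1 hf
  filter_upwards [eventually_all.2 fun i => ev_lift (a i)] with T hT g' hg' f' hf'
  choose a' ha' using hT
  refine (Ideal.mem_span_range_iff_exists_fun).2 ⟨a', psiMap_injective _ _ ?_⟩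
  rw [hf', ← ha, map_sum]
  exact Finset.sum_congr rfl fun i _ => by rw [map_mul, ha', hg']

theorem coeff_linear_mem {A σ : Type*} [CommRing A] (m : Ideal A)
    (L : MvPolynomial σ A →ₗ[A] MvPolynomial σ A) (f : MvPolynomial σ A)
    (hf : ∀ e, MvPolynomial.coeff e f ∈ m) (e : σ →₀ ℕ) : MvPolynomial.coeff e (L f) ∈ m := by
  have h1 : f = ∑ e ∈ f.support, (MvPolynomial.coeff e f) • monomial e (1 : A) := by
    conv_lhs => rw [← support_sum_monomial_coeff f]
    exact Finset.sum_congr rfl fun e _ => by simp [smul_monomial]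
  rw [h1, map_sum, coeff_sum]
  refine sum_mem fun e' _ => ?_
  rw [map_smul, coeff_smul, smul_eq_mul]
  exact Ideal.mul_mem_right _ _ (hf e')

theorem isJacobsonRing_int : IsJacobsonRing ℤ := by
  rw [isJacobsonRing_iff_prime_eq]
  intro P hP
  by_cases h0 : P = ⊥
  · subst h0
    refine le_antisymm ?_ Ideal.le_jacobson
    intro x hx
    rw [Ideal.mem_jacobson_bot] at hx
    have h1 := hx (3 * x)
    by_contra hx0
    have hx0' : x ≠ 0 := hx0
    have h2 : 0 < x ^ 2 := by positivity
    rcases Int.isUnit_iff.1 h1 with h | h <;> nlinarith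
  · have : P.IsMaximal := hP.isMaximal h0
    exact Ideal.jacobson_eq_self_of_isMaximal

/-- A finitely generated `ℤ`-subalgebra of a field has enough maximal ideals, and they have
residue fields of positive characteristic. -/
theorem exists_good_maximal {k : Type*} [Field k] (T : Finset k) (b : finAdj T) (hb : b ≠ 0) :
    ∃ m : Ideal (finAdj T), m.IsMaximal ∧ b ∉ m ∧
      ∃ p : ℕ, p.Prime ∧ CharP (finAdj T ⧸ m) p := by
  have hft : Algebra.FiniteType ℤ (finAdj T) :=
    (Subalgebra.fg_iff_finiteType _).1 (Subalgebra.fg_adjoin_finset T)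
  have hZ := isJacobsonRing_int
  have hjac : IsJacobsonRing (finAdj T) := isJacobsonRing_of_finiteType (A := ℤ)
  have h1 : ∃ m : Ideal (finAdj T), m.IsMaximal ∧ b ∉ m := by
    by_contra hcon
    push Not at hcon
    have h2 : b ∈ (⊥ : Ideal (finAdj T)).jacobson := by
      rw [Ideal.jacobson, Ideal.mem_sInf]
      intro m hm
      exact hcon m hm.2
    rw [← Ideal.radical_eq_jacobson] at h2
    obtain ⟨n, hn⟩ := h2
    exact hb (eq_zero_of_pow_eq_zero ((Ideal.mem_bot).1 hn))
  obtain ⟨m, hm, hbm⟩ := h1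
  refine ⟨m, hm, hbm, ringChar (finAdj T ⧸ m), ?_, inferInstance⟩
  let _ : Field (finAdj T ⧸ m) := Ideal.Quotient.field m
  have hft2 : Algebra.FiniteType ℤ (finAdj T ⧸ m) :=
    hft.of_surjective (Ideal.Quotient.mkₐ ℤ m) Ideal.Quotient.mk_surjective
  have hfin : Module.Finite ℤ (finAdj T ⧸ m) := finite_of_finite_type_of_isJacobsonRing _ _
  rcases CharP.char_is_prime_or_zero (finAdj T ⧸ m) (ringChar (finAdj T ⧸ m)) with h | h
  · exact h
  · exfalso
    have : CharZero (finAdj T ⧸ m) := by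
      have := ringChar.charP (finAdj T ⧸ m)
      rw [h] at this
      exact CharP.charP_to_charZero _
    have hinj : Function.Injective (algebraMap ℤ (finAdj T ⧸ m)) := by
      intro x y hxy
      simpa using hxy
    have hint : Algebra.IsIntegral ℤ (finAdj T ⧸ m) := inferInstance
    exact Int.not_isField (isField_of_isIntegral_of_isField hinj (Field.toIsField _))

end Reduction

section CharZero

open MvPolynomial Filter

theorem map_mk_eq_zero_iff {A σ : Type*} [CommRing A] (m : Ideal A) (f : MvPolynomial σ A) :
    map (Ideal.Quotient.mk m) f = 0 ↔ ∀ e, MvPolynomial.coeff e f ∈ m := by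
  rw [MvPolynomial.ext_iff]
  refine forall_congr' fun e => ?_
  rw [coeff_map, coeff_zero, Ideal.Quotient.eq_zero_iff_mem]

theorem charzero_main {k : Type*} {N : ℕ} [Field k] (I : Ideal (MvPolynomial (Fin N) k))
    (h n : ℕ) (hh : 1 ≤ h) (hn : 1 ≤ n) {ι : Type*} [Fintype ι]
    (c : ι → MvPolynomial (Fin N) k) (g : ι → Fin h → MvPolynomial (Fin N) k)
    (u : MvPolynomial (Fin N) k) (hgI : ∀ j l, g j l ∈ I)
    (hcI : ∀ j, ∀ f ∈ I, c j * f ∈ Ideal.span (Set.range (g j)))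
    (hcu : ∀ j, c j * u ∈ I ^ (h * n))
    (hD : ∀ y, (∑ j, c j ^ (h + 2)) * y ∈ I → y ∈ I) : u ∈ I ^ n := by
  classical
  by_contra hu
  obtain ⟨GrI, hGI, hGI2⟩ := groebner_aux I
  obtain ⟨Grn, hGn, hGn2⟩ := groebner_aux (I ^ n)
  obtain ⟨GrL, hGL, hGL2⟩ := groebner_aux (I ⊔ Ideal.span {∑ j, c j ^ (h + 2)})
  have hGL' : ∀ f : GrL, ∃ i ∈ I, ∃ a, i + a * (∑ j, c j ^ (h + 2)) = f := by
    intro f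
    obtain ⟨i, hi, z, hz, hiz⟩ := Submodule.mem_sup.1 (hGL f f.2)
    obtain ⟨a, rfl⟩ := Ideal.mem_span_singleton'.1 hz
    exact ⟨i, hi, a, hiz⟩
  choose iL hiL aL haL using hGL'
  have ev1 := ev_lift u
  have ev2 := eventually_all.2 fun j => ev_lift (c j)
  have ev3 := eventually_all.2 fun j => eventually_all.2 fun l => ev_lift (g j l)
  have ev4 := eventually_all.2 fun j => ev_pow I (h * n) _ (hcu j)
  have ev5 := eventually_all.2 fun j => eventually_all.2 fun f : GrI =>
    ev_span (g j) _ (hcI j f (hGI f f.2))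
  have ev6 := eventually_all.2 fun f : GrI => ev_lift (f : MvPolynomial (Fin N) k)
  have ev7 := eventually_all.2 fun f : Grn => ev_lift (f : MvPolynomial (Fin N) k)
  have ev8 := eventually_all.2 fun f : GrL => ev_lift (f : MvPolynomial (Fin N) k)
  have ev9 := eventually_all.2 fun f : GrL => ev_lift (iL f)
  have ev10 := eventually_all.2 fun f : GrL => ev_lift (aL f)
  obtain ⟨T, ⟨u', hu'⟩, h2, h3, h4, h5, h6, h7, h8, h9, h10⟩ :=
    (ev1.and (ev2.and (ev3.and (ev4.and (ev5.and (ev6.and (ev7.and (ev8.and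
      (ev9.and ev10))))))))).exists
  choose c' hc' using h2
  choose g' hg' using h3
  choose iL' hiL' using h9
  choose aL' haL' using h10
  set ψ := psiMap (Fin N) (finAdj T) with hψ
  have hψinj : Function.Injective ψ := psiMap_injective _ _
  obtain ⟨remI, hI1, hI2⟩ := hGI2 (finAdj T) fun f hf => h6 ⟨f, hf⟩
  obtain ⟨remn, hn1, hn2⟩ := hGn2 (finAdj T) fun f hf => h7 ⟨f, hf⟩
  obtain ⟨remL, hL1, hL2⟩ := hGL2 (finAdj T) fun f hf => h8 ⟨f, hf⟩
  have hr : remn u' ≠ 0 := by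
    intro h0
    have h1 := hn1 u'
    rw [h0, sub_zero] at h1
    have h2 : Ideal.span {g' | ψ g' ∈ Grn} ≤ (I ^ n).comap ψ := by
      rw [Ideal.span_le]
      intro x hx
      exact hGn _ hx
    have h3 := h2 h1
    rw [Ideal.mem_comap, hu'] at h3
    exact hu h3
  obtain ⟨e0, he0⟩ := MvPolynomial.ne_zero_iff.1 hr
  obtain ⟨m, hm, hbm, p, hp, hpc⟩ := exists_good_maximal T _ he0
  letI := Ideal.Quotient.field m
  haveI : Fact p.Prime := ⟨hp⟩
  set D' := ∑ j, c' j ^ (h + 2) with hD'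
  have hψD : ψ D' = ∑ j, c j ^ (h + 2) := by
    simp only [hD', map_sum, map_pow, hc']
  set φ : MvPolynomial (Fin N) (finAdj T) →+* MvPolynomial (Fin N) (finAdj T ⧸ m) :=
    map (Ideal.Quotient.mk m) with hφ
  have hφs : Function.Surjective φ := MvPolynomial.map_surjective _ Ideal.Quotient.mk_surjective
  have hφ0 : ∀ f, φ f = 0 ↔ ∀ e, MvPolynomial.coeff e f ∈ m := map_mk_eq_zero_iff m
  set IT := I.comap ψ with hIT
  have key : φ u' ∈ (IT.map φ) ^ n := by
    refine charp_main p (IT.map φ) h n hh hn (fun j => φ (c' j)) (fun j l => φ (g' j l)) (φ u')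
      ?_ ?_ ?_ ?_
    · intro j l
      refine Ideal.mem_map_of_mem _ ?_
      rw [hIT, Ideal.mem_comap, hg']
      exact hgI j l
    · intro j f hf
      obtain ⟨f', hf', rfl⟩ := (Ideal.mem_map_iff_of_surjective φ hφs).1 hf
      have h1 : f' ∈ Ideal.span {g' | ψ g' ∈ GrI} := by
        have := hI1 f'
        rwa [hI2 f' hf', sub_zero] at this
      have h2 : Ideal.span {g' | ψ g' ∈ GrI} ≤
          Submodule.comap (LinearMap.mulLeft _ (c' j)) (Ideal.span (Set.range (g' j))) := by
        rw [Ideal.span_le]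
        intro x hx
        refine h5 j ⟨ψ x, hx⟩ (g' j) (hg' j) _ ?_
        simp [hc', map_mul, ← hψ]
      have h3 : c' j * f' ∈ Ideal.span (Set.range (g' j)) := h2 h1
      have h4 := Ideal.mem_map_of_mem φ h3
      rw [Ideal.map_span, ← Set.range_comp, map_mul] at h4
      exact h4
    · intro j
      obtain ⟨f', hf', hf''⟩ := h4 j
      have : f' = c' j * u' := hψinj (by rw [hf'', map_mul, hc', hu'])
      rw [this] at hf'
      have h5 := Ideal.mem_map_of_mem φ hf'
      rwa [Ideal.map_pow, map_mul] at h5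
    · intro y hy
      obtain ⟨y', rfl⟩ := hφs y
      have e1 : (∑ j, φ (c' j) ^ (h + 2)) * φ y' = φ (D' * y') := by
        simp only [hD', map_mul, map_sum, map_pow]
      rw [e1] at hy
      obtain ⟨i, hi, hiy⟩ := (Ideal.mem_map_iff_of_surjective φ hφs).1 hy
      set z := D' * y' - i with hz
      have hzm : ∀ e, MvPolynomial.coeff e z ∈ m := by
        rw [← hφ0, hz, map_sub, hiy, sub_self]
      have hrz : remL z = 0 := by
        refine hL2 z ?_
        have : ψ z = (∑ j, c j ^ (h + 2)) * ψ y' - ψ i := by rw [hz, map_sub, map_mul, hψD]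
        rw [← hψ, this]
        refine Ideal.sub_mem _ (Ideal.mul_mem_right _ _ (Ideal.mem_sup_right
          (Ideal.mem_span_singleton_self _))) (Ideal.mem_sup_left hi)
      have hL3 : Ideal.span {g' | ψ g' ∈ GrL} ≤ IT ⊔ Ideal.span {D'} := by
        rw [Ideal.span_le]
        intro x hx
        have : x = iL' ⟨ψ x, hx⟩ + aL' ⟨ψ x, hx⟩ * D' := by
          refine hψinj ?_
          rw [map_add, map_mul, hψD, hiL', haL', haL]
        rw [this]
        refine Ideal.add_mem _ (Ideal.mem_sup_left ?_) (Ideal.mul_mem_left _ _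
          (Ideal.mem_sup_right (Ideal.mem_span_singleton_self _)))
        rw [hIT, Ideal.mem_comap, hiL']
        exact hiL _
      have hmon : ∀ e : Fin N →₀ ℕ, ∃ ie ∈ IT, ∃ we,
          ie + we * D' = monomial e 1 - remL (monomial e 1) := by
        intro e
        obtain ⟨i, hi, z, hz, hiz⟩ := Submodule.mem_sup.1 (hL3 (hL1 (monomial e 1)))
        obtain ⟨a, rfl⟩ := Ideal.mem_span_singleton'.1 hz
        exact ⟨i, hi, a, hiz⟩
      choose im him wm hwm using hmon
      have hzs : z = ∑ e ∈ z.support, (MvPolynomial.coeff e z) • monomial e (1 : finAdj T) := by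
        conv_lhs => rw [← support_sum_monomial_coeff z]
        exact Finset.sum_congr rfl fun e _ => by simp [smul_monomial]
      have hzs2 : z = ∑ e ∈ z.support, (MvPolynomial.coeff e z) • (im e + wm e * D') := by
        simp only [hwm, smul_sub, Finset.sum_sub_distrib]
        rw [← hzs]
        have : ∑ e ∈ z.support, MvPolynomial.coeff e z • remL (monomial e 1) = remL z := by
          conv_rhs => rw [hzs]
          simp only [map_sum, map_smul]
        rw [this, hrz, sub_zero]
      set w := ∑ e ∈ z.support, (MvPolynomial.coeff e z) • wm e with hw
      have hi' : ∑ e ∈ z.support, (MvPolynomial.coeff e z) • im e ∈ IT :=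
        sum_mem fun e _ => Submodule.smul_of_tower_mem _ _ (him e)
      have hzw : z = ∑ e ∈ z.support, (MvPolynomial.coeff e z) • im e + w * D' := by
        conv_lhs => rw [hzs2]
        simp only [smul_add, Finset.sum_add_distrib, hw, Finset.sum_mul, smul_mul_assoc]
      have hφw : φ w = 0 := by
        rw [hφ0]
        intro e
        rw [hw, coeff_sum]
        refine sum_mem fun e' _ => ?_
        rw [coeff_smul, smul_eq_mul]
        exact Ideal.mul_mem_right _ _ (hzm e')
      have hfin : D' * (y' - w) ∈ IT := by
        have : D' * (y' - w) = i + ∑ e ∈ z.support, (MvPolynomial.coeff e z) • im e := by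
          have h1 : D' * y' = z + i := by rw [hz]; ring
          rw [mul_sub, h1]
          linear_combination hzw
        rw [this]
        exact Ideal.add_mem _ hi hi'
      have hyw : y' - w ∈ IT := by
        rw [hIT, Ideal.mem_comap, map_mul, hψD] at hfin
        exact hD _ hfin
      have := Ideal.mem_map_of_mem φ hyw
      rwa [map_sub, hφw, sub_zero] at this
  rw [← Ideal.map_pow] at key
  obtain ⟨v, hv, hvu⟩ := (Ideal.mem_map_iff_of_surjective φ hφs).1 key
  have hv2 : ψ v ∈ I ^ n := by
    have : IT ^ n ≤ (I ^ n).comap ψ := Ideal.le_comap_pow ψ n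
    exact this hv
  have hrv := hn2 v hv2
  have h11 : ∀ e, MvPolynomial.coeff e (u' - v) ∈ m := by
    rw [← hφ0, map_sub, hvu, sub_self]
  have h12 := coeff_linear_mem m remn _ h11 e0
  rw [map_sub, hrv, sub_zero] at h12
  exact hbm h12

end CharZero

/-- **Ein–Lazarsfeld–Smith (2001); Hochster–Huneke (2002).** If `h` is the largest
height of a minimal prime of a nonzero proper radical ideal `I` of `k[X_0, …, X_d]`,
then `I^{(hn)} ⊆ I^n` for all `n ≥ 1`. -/
theorem ein_lazarsfeld_smith (k : Type*) [Field k] (d : ℕ)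
    (I : Ideal (MvPolynomial (Fin (d + 1)) k))
    (hne : I ≠ ⊥) (hproper : I ≠ ⊤) (hrad : I.radical = I)
    (h : ℕ)
    (hmax : IsGreatest {m : ℕ∞ | ∃ q ∈ I.minimalPrimes, idealHeight q = m} (h : ℕ∞)) :
    ∀ n : ℕ, 1 ≤ n → symbolicPower I (h * n) ≤ I ^ n := by
  intro n hn u hu
  classical
  have hheight : ∀ q ∈ I.minimalPrimes, q.height ≤ (h : ℕ∞) := by
    intro q hq
    haveI := hq.1.1
    refine le_trans ?_ (hmax.2 ⟨q, hq, rfl⟩)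
    refine le_iInf₂ fun p hp => ?_
    rw [← PrimeSpectrum.height_eq_orderHeight]
    exact Ideal.height_mono hp
  have hh : 1 ≤ h := by
    obtain ⟨q, hq⟩ := Ideal.nonempty_minimalPrimes hproper
    by_contra hcon
    have h0 : h = 0 := by omega
    have h1 := hheight q hq
    rw [h0, Nat.cast_zero, nonpos_iff_eq_zero, Ideal.height_eq_zero_iff_eq_bot] at h1
    have h2 := hq.1.2
    rw [h1] at h2
    exact hne (le_bot_iff.1 h2)
  have hfin : I.minimalPrimes.Finite := Ideal.finite_minimalPrimes_of_isNoetherianRing _ I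
  haveI : Fintype I.minimalPrimes := hfin.fintype
  have hI : ∀ x, (∀ P : I.minimalPrimes, x ∈ (P : Ideal (MvPolynomial (Fin (d + 1)) k))) → x ∈ I := by
    intro x hx
    rw [← hrad, ← Ideal.sInf_minimalPrimes, Submodule.mem_sInf]
    exact fun P hP => hx ⟨P, hP⟩
  have hpr : ∀ P : I.minimalPrimes, (P : Ideal (MvPolynomial (Fin (d + 1)) k)).IsPrime := fun P => P.2.1.1
  have ht : ∀ P : I.minimalPrimes, ∃ t ∉ (P : Ideal (MvPolynomial (Fin (d + 1)) k)),
      ∀ Q : I.minimalPrimes, Q ≠ P → t ∈ (Q : Ideal (MvPolynomial (Fin (d + 1)) k)) := by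
    intro P
    by_contra hcon
    push Not at hcon
    have h1 : (Finset.univ.erase P).inf (fun Q : I.minimalPrimes => (Q : Ideal (MvPolynomial (Fin (d + 1)) k))) ≤
        (P : Ideal (MvPolynomial (Fin (d + 1)) k)) := by
      intro t htt
      by_contra htP
      obtain ⟨Q, hQ, htQ⟩ := hcon t htP
      exact htQ ((Finset.inf_le (f := fun Q : I.minimalPrimes => (Q : Ideal (MvPolynomial (Fin (d + 1)) k)))
        (Finset.mem_erase.2 ⟨hQ, Finset.mem_univ Q⟩)) htt)
    obtain ⟨Q, hQ, hQP⟩ := ((hpr P).inf_le').1 h1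
    refine (Finset.mem_erase.1 hQ).1 (Subtype.ext (le_antisymm hQP ?_))
    exact P.2.2 Q.2.1 hQP
  choose t htP htQ using ht
  have hs : ∀ P : I.minimalPrimes, ∃ s ∉ (P : Ideal (MvPolynomial (Fin (d + 1)) k)), s * u ∈ I ^ (h * n) := fun P => hu P P.2
  choose s hsP hsu using hs
  have hg : ∀ P : I.minimalPrimes, ∃ g : Fin h → MvPolynomial (Fin (d + 1)) k,
      (∀ l, g l ∈ (P : Ideal (MvPolynomial (Fin (d + 1)) k))) ∧ ∃ r ∉ (P : Ideal (MvPolynomial (Fin (d + 1)) k)), ∀ f ∈ (P : Ideal (MvPolynomial (Fin (d + 1)) k)),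
        r * f ∈ Ideal.span (Set.range g) := fun P =>
    haveI := hpr P
    reg_aux (P : Ideal (MvPolynomial (Fin (d + 1)) k)) h (hheight P P.2)
  choose g hgP r hrP hrg using hg
  have hgI : ∀ P l, t P * g P l ∈ I := by
    intro P l
    refine hI _ fun Q => ?_
    by_cases hQ : Q = P
    · rw [hQ]
      exact Ideal.mul_mem_left _ _ (hgP P l)
    · exact Ideal.mul_mem_right _ _ (htQ P Q hQ)
  have hcI : ∀ P, ∀ f ∈ I, (t P * s P * r P) * f ∈
      Ideal.span (Set.range fun l => t P * g P l) := by
    intro P f hf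
    obtain ⟨a, ha⟩ := Ideal.mem_span_range_iff_exists_fun.1 (hrg P f (P.2.1.2 hf))
    refine Ideal.mem_span_range_iff_exists_fun.2 ⟨fun l => s P * a l, ?_⟩
    calc ∑ l, s P * a l * (t P * g P l) = ∑ l, (t P * s P) * (a l * g P l) :=
          Finset.sum_congr rfl fun l _ => by ring
      _ = (t P * s P) * (r P * f) := by rw [← Finset.mul_sum, ha]
      _ = _ := by ring
  have hcu : ∀ P, (t P * s P * r P) * u ∈ I ^ (h * n) := by
    intro P
    have : (t P * s P * r P) * u = (t P * r P) * (s P * u) := by ring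
    rw [this]
    exact Ideal.mul_mem_left _ _ (hsu P)
  have hD : ∀ y, (∑ P, (t P * s P * r P) ^ (h + 2)) * y ∈ I → y ∈ I := by
    intro y hy
    refine hI _ fun P => ?_
    have hP := hpr P
    refine (hP.mem_or_mem (P.2.1.2 hy)).resolve_left fun hcon => ?_
    rw [← Finset.add_sum_erase _ _ (Finset.mem_univ P)] at hcon
    have h1 : ∑ Q ∈ Finset.univ.erase P, (t Q * s Q * r Q) ^ (h + 2) ∈ (P : Ideal (MvPolynomial (Fin (d + 1)) k)) := by
      refine sum_mem fun Q hQ => ?_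
      refine Ideal.pow_mem_of_mem _ ?_ _ (by omega)
      exact Ideal.mul_mem_right _ _ (Ideal.mul_mem_right _ _
        (htQ Q P (Finset.mem_erase.1 hQ).1.symm))
    have h2 := hP.mem_of_pow_mem _ ((Ideal.add_mem_iff_left _ h1).1 hcon)
    rcases hP.mem_or_mem h2 with h3 | h3
    · exact (hP.mem_or_mem h3).elim (htP P) (hsP P)
    · exact hrP P h3
  obtain ⟨p, hp⟩ := CharP.exists k
  rcases CharP.char_is_prime_or_zero k p with hpp | hp0
  · haveI : Fact p.Prime := ⟨hpp⟩
    exact charp_main p I h n hh hn _ _ u hgI hcI hcu hD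
  · exact charzero_main I h n hh hn _ _ u hgI hcI hcu hD
end

section
/- Let k be a field, S = k[X_0,…,X_d] with the standard grading, and let I be a nonzero proper homogeneous radical ideal of S. Then the Waldschmidt constant γ(I) = inf_{n≥1} α(I^{(n)})/n satisfies γ(I) ≥ 1, γ(I) ≤ α(I), and α(I)/γ(I) ≤ ρ(I); in particular 1 ≤ α(I)/γ(I) ≤ ρ(I). -/
attribute [local instance] MvPolynomial.gradedAlgebra

/-- `α(J)`: the least degree of a nonzero homogeneous element of `J`. -/
noncomputable def alphaDeg {k : Type*} [Field k] {d : ℕ}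
    (J : Ideal (MvPolynomial (Fin d) k)) : ℕ :=
  sInf {n : ℕ | ∃ f ∈ J, f ≠ 0 ∧ f.IsHomogeneous n}

/-- The Waldschmidt constant `γ(I) = inf_{n ≥ 1} α(I^{(n)})/n`. -/
noncomputable def waldschmidt {k : Type*} [Field k] {d : ℕ}
    (I : Ideal (MvPolynomial (Fin d) k)) : ℝ :=
  sInf {x : ℝ | ∃ n : ℕ, 0 < n ∧ x = (alphaDeg (symbolicPower I n) : ℝ) / n}

/-- The resurgence `ρ(I) = sup { m/r : I^{(m)} ⊄ I^r }`. -/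
noncomputable def resurgence {k : Type*} [Field k] {d : ℕ}
    (I : Ideal (MvPolynomial (Fin d) k)) : ℝ :=
  sSup {x : ℝ | ∃ m r : ℕ, 0 < m ∧ 0 < r ∧ ¬ symbolicPower I m ≤ I ^ r ∧ x = (m : ℝ) / r}


theorem wr_artin_rees {B : Type*} [CommRing B] [IsNoetherianRing B] (u : B)
    (hu : u ∈ nonZeroDivisors B) (P : Ideal B) :
    ∃ c : ℕ, ∀ N : ℕ, ∀ y s : B, s * (u * y) ∈ P ^ (N + c) → s * y ∈ P ^ N := by
  obtain ⟨c, hc⟩ := Ideal.exists_pow_inf_eq_pow_smul P (Ideal.span {u} : Submodule B B)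
  refine ⟨c, fun N y s h => ?_⟩
  have h1 := hc (N + c) (by omega)
  have h2 : s * (u * y) ∈ P ^ (N + c) • (⊤ : Submodule B B) ⊓ (Ideal.span {u} : Submodule B B) := by
    refine ⟨?_, ?_⟩
    · simpa using h
    · exact Ideal.mem_span_singleton.2 ⟨s * y, by ring⟩
  rw [h1, Nat.add_sub_cancel] at h2
  have h3 : s * (u * y) ∈ P ^ N * Ideal.span {u} := by
    exact Ideal.mul_mono_right inf_le_right h2
  rw [Ideal.mem_mul_span_singleton] at h3
  obtain ⟨z, hz, hzu⟩ := h3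
  have : z = s * y := by
    apply (mul_cancel_right_mem_nonZeroDivisors hu).1
    rw [hzu]; ring
  exact this ▸ hz

theorem wr_principal {B : Type*} [CommRing B] [IsNoetherianRing B] (u : B)
    (hu : u ∈ nonZeroDivisors B) :
    ∃ T : Finset (Ideal B), (∀ P ∈ T, P.IsPrime ∧ u ∈ P) ∧
      ∃ K : ℕ, ∀ n : ℕ, ∀ x : B, (∀ P ∈ T, ∃ s ∉ P, s * x ∈ P ^ (K * n)) → ∃ b, x = u ^ n * b := by
  classical
  obtain ⟨Qs, hinf, hprim⟩ := Submodule.isLasker B B (Ideal.span {u})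
  have hprim' : ∀ Q ∈ Qs, Ideal.IsPrimary Q := fun Q hQ => hprim hQ
  have hk : ∀ Q : Ideal B, ∃ k : ℕ, Q.radical ^ k ≤ Q := fun Q =>
    Q.exists_radical_pow_le_of_fg (IsNoetherian.noetherian _)
  choose k hk using hk
  choose c hc using wr_artin_rees u hu
  refine ⟨Qs.image Ideal.radical, ?_, ?_⟩
  · intro P hP
    obtain ⟨Q, hQ, rfl⟩ := Finset.mem_image.1 hP
    refine ⟨Ideal.isPrime_radical (hprim' Q hQ), Ideal.le_radical ?_⟩
    have : Qs.inf id ≤ Q := Finset.inf_le hQ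
    rw [hinf] at this
    exact this (Ideal.mem_span_singleton_self u)
  · let K := ∑ Q ∈ Qs, (k Q + c (Ideal.radical Q))
    have hK : ∀ Q ∈ Qs, k Q + c (Ideal.radical Q) ≤ K := fun Q hQ =>
      Finset.single_le_sum (f := fun Q => k Q + c (Ideal.radical Q)) (fun _ _ => Nat.zero_le _) hQ
    refine ⟨K, fun n => ?_⟩
    induction n with
    | zero => exact fun x _ => ⟨x, by simp⟩
    | succ n ih =>
      intro x hx
      have hxu : x ∈ Ideal.span {u} := by
        rw [← hinf]
        refine (Submodule.mem_finsetInf (p := id)).2 fun Q hQ => ?_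
        obtain ⟨s, hs, hsx⟩ := hx (Ideal.radical Q) (Finset.mem_image_of_mem _ hQ)
        have h1 : s * x ∈ Q := hk Q (Ideal.pow_le_pow_right (by
          have := hK Q hQ
          nlinarith) hsx)
        have := (Ideal.isPrimary_iff.1 (hprim' Q hQ)).2 (mul_comm s x ▸ h1)
        exact this.resolve_right hs
      obtain ⟨y, rfl⟩ := Ideal.mem_span_singleton.1 hxu
      obtain ⟨b, rfl⟩ := ih y (by
        intro P hP
        obtain ⟨s, hs, hsx⟩ := hx P hP
        refine ⟨s, hs, hc P _ _ _ (Ideal.pow_le_pow_right ?_ hsx)⟩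
        obtain ⟨Q, hQ, rfl⟩ := Finset.mem_image.1 hP
        have := hK Q hQ
        nlinarith)
      exact ⟨b, by ring⟩

section
open MvPolynomial

theorem wr_ker_const {σ E : Type*} [CommRing E] (f : MvPolynomial σ E) :
    f ∈ idealOfVars σ E ↔ constantCoeff f = 0 := by
  have := mem_pow_idealOfVars_iff' 1 f
  rw [pow_one] at this
  rw [this]
  constructor
  · intro h; exact h 0 (by simp)
  · intro h x hx
    have : x = 0 := by
      exact (Finsupp.degree_eq_zero_iff x).1 (by omega)
    subst this; exact h

theorem wr_primary {σ E : Type*} [CommRing E] [IsDomain E] (a b : MvPolynomial σ E) (m : ℕ)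
    (ha : constantCoeff a ≠ 0) (hab : a * b ∈ idealOfVars σ E ^ m) : b ∈ idealOfVars σ E ^ m := by
  have key : ∀ f : MvPolynomial σ E, f ∈ idealOfVars σ E ^ m ↔
      (m : ℕ∞) ≤ (f : MvPowerSeries σ E).order := by
    intro f
    rw [mem_pow_idealOfVars_iff']
    constructor
    · intro h
      refine MvPowerSeries.le_order fun d hd => ?_
      rw [MvPolynomial.coeff_coe]
      exact h d (by exact_mod_cast hd)
    · intro h x hx
      rw [← MvPolynomial.coeff_coe]
      exact MvPowerSeries.coeff_of_lt_order (lt_of_lt_of_le (by exact_mod_cast hx) h)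
  rw [key] at hab ⊢
  rw [MvPolynomial.coe_mul, MvPowerSeries.order_mul] at hab
  have h0 : (a : MvPowerSeries σ E).order = 0 := by
    by_contra h
    apply ha
    have := MvPowerSeries.coeff_of_lt_order (f := (a : MvPowerSeries σ E)) (d := 0)
      (by simpa using pos_iff_ne_zero.2 h)
    rwa [MvPolynomial.coeff_coe] at this
  rwa [h0, zero_add] at hab

/-- The Taylor expansion `g(X) ↦ g(X + Y)`. -/
noncomputable def wrTaylor (σ D : Type*) [CommRing D] :
    MvPolynomial σ D →+* MvPolynomial σ (MvPolynomial σ D) :=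
  eval₂Hom (C.comp C) (fun i => C (X i) + X i)

theorem wr_taylor_const {σ D : Type*} [CommRing D] (g : MvPolynomial σ D) :
    constantCoeff (wrTaylor σ D g) = g := by
  have : (constantCoeff.comp (wrTaylor σ D)) = RingHom.id _ := by
    ext i <;> simp [wrTaylor]
  exact (DFunLike.congr_fun this g)

theorem wr_taylor_coeff {σ D : Type*} [CommRing D] (q : Ideal (MvPolynomial σ D))
    [q.IsPrime] (g s : MvPolynomial σ D) (m : ℕ) (hs : s ∉ q) (h : s * g ∈ q ^ m)
    (a : σ →₀ ℕ) (ha : a.degree < m) : (wrTaylor σ D g).coeff a ∈ q := by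
  let θ : MvPolynomial σ D →+* MvPolynomial σ (MvPolynomial σ D ⧸ q) :=
    (map (Ideal.Quotient.mk q)).comp (wrTaylor σ D)
  have hθ : ∀ f, constantCoeff (θ f) = Ideal.Quotient.mk q f := by
    intro f
    simp only [θ, RingHom.comp_apply, constantCoeff_map, wr_taylor_const]
  have hq : q.map θ ≤ idealOfVars σ (MvPolynomial σ D ⧸ q) := by
    rw [Ideal.map_le_iff_le_comap]
    intro f hf
    rw [Ideal.mem_comap, wr_ker_const, hθ]
    exact Ideal.Quotient.eq_zero_iff_mem.2 hf
  have h1 : θ s * θ g ∈ idealOfVars σ (MvPolynomial σ D ⧸ q) ^ m := by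
    rw [← map_mul]
    have := Ideal.mem_map_of_mem θ h
    rw [Ideal.map_pow] at this
    exact Ideal.pow_right_mono hq m this
  have h2 := wr_primary _ _ m (by
    rw [hθ]; exact fun h => hs (Ideal.Quotient.eq_zero_iff_mem.1 h)) h1
  rw [mem_pow_idealOfVars_iff'] at h2
  have := h2 a ha
  simp only [θ, RingHom.comp_apply, coeff_map] at this
  exact Ideal.Quotient.eq_zero_iff_mem.1 this

noncomputable def wrShift {ι D K : Type*} [CommRing D] [Field K] [Algebra D K] (x : ι → K) :
    MvPolynomial ι D →+* MvPolynomial ι K :=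
  eval₂Hom (C.comp (algebraMap D K)) (fun i => X i + C (x i))

theorem wr_shift_eq {ι D K : Type*} [CommRing D] [Field K] [Algebra D K] (x : ι → K)
    (g : MvPolynomial ι D) :
    wrShift x g = map (aeval x : MvPolynomial ι D →ₐ[D] K).toRingHom (wrTaylor ι D g) := by
  have : wrShift x = (map (aeval x : MvPolynomial ι D →ₐ[D] K).toRingHom).comp (wrTaylor ι D) := by
    apply MvPolynomial.ringHom_ext
    · intro r; simp [wrShift, wrTaylor]
    · intro i; simp [wrShift, wrTaylor, add_comm]
  exact (DFunLike.congr_fun this g)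

section
attribute [local instance] MvPolynomial.algebraMvPolynomial

theorem wr_shift_flat {ι D K : Type*} [CommRing D] [Field K] [Algebra D K] [Module.Flat D K]
    (x : ι → K) : (wrShift (D := D) x).Flat := by
  let e1 : MvPolynomial ι K →+* MvPolynomial ι K := eval₂Hom C (fun i => X i + C (x i))
  let e2 : MvPolynomial ι K →+* MvPolynomial ι K := eval₂Hom C (fun i => X i - C (x i))
  have h12 : e1.comp e2 = RingHom.id _ := by
    apply MvPolynomial.ringHom_ext
    · intro r; simp [e1, e2]
    · intro i; simp [e1, e2]
  have h21 : e2.comp e1 = RingHom.id _ := by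
    apply MvPolynomial.ringHom_ext
    · intro r; simp [e1, e2]
    · intro i; simp [e1, e2]
  have he1 : e1.Flat := RingHom.Flat.of_bijective
    ⟨Function.LeftInverse.injective (g := e2) fun a => (DFunLike.congr_fun h21 a),
     Function.RightInverse.surjective (g := e2) fun a => (DFunLike.congr_fun h12 a)⟩
  have h : wrShift (D := D) x = e1.comp (algebraMap (MvPolynomial ι D) (MvPolynomial ι K)) := by
    have hm : algebraMap (MvPolynomial ι D) (MvPolynomial ι K) = map (algebraMap D K) := rfl
    rw [hm]
    apply MvPolynomial.ringHom_ext
    · intro r; simp [wrShift, e1]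
    · intro i; simp [wrShift, e1]
  rw [h]
  refine RingHom.Flat.comp ?_ he1
  rw [RingHom.flat_algebraMap_iff]
  exact Module.Flat.of_linearEquiv
    (Algebra.IsPushout.equiv D (MvPolynomial ι D) K (MvPolynomial ι K)).symm.toLinearEquiv

end

theorem wr_descend {R A : Type*} [CommRing R] [CommRing A] (f : R →+* A) (hf : f.Flat)
    (M : Ideal A) [M.IsPrime] (p : Ideal R) [p.IsPrime] (hp : p = M.comap f) (J : Ideal R)
    (g : R) (s : A) (hs : s ∉ M) (h : s * f g ∈ J.map f) : ∃ t ∉ p, t * g ∈ J := by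
  let F : Localization.AtPrime p →+* Localization.AtPrime M :=
    Localization.localRingHom p M f hp
  have hF : F.Flat := hf.localRingHom M p hp
  have hloc : IsLocalHom F := Localization.isLocalHom_localRingHom _ _ _ _
  algebraize [F]
  have hloc' : IsLocalHom (algebraMap (Localization.AtPrime p) (Localization.AtPrime M)) := hloc
  have ff : Module.FaithfullyFlat (Localization.AtPrime p) (Localization.AtPrime M) :=
    Module.FaithfullyFlat.of_flat_of_isLocalHom
  have h1 := Ideal.comap_map_eq_self_of_faithfullyFlat (B := Localization.AtPrime M)
    (J.map (algebraMap R (Localization.AtPrime p)))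
  have h2 : algebraMap R (Localization.AtPrime p) g ∈
      J.map (algebraMap R (Localization.AtPrime p)) := by
    rw [← h1, Ideal.mem_comap, Ideal.map_map]
    have hcomp : (algebraMap (Localization.AtPrime p) (Localization.AtPrime M)).comp
        (algebraMap R (Localization.AtPrime p)) =
        (algebraMap A (Localization.AtPrime M)).comp f := by
      ext a
      exact Localization.localRingHom_to_map _ _ _ hp a
    rw [← RingHom.comp_apply, hcomp, ← Ideal.map_map, RingHom.comp_apply]
    have h3 := Ideal.mem_map_of_mem (algebraMap A (Localization.AtPrime M)) h
    rw [map_mul] at h3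
    have hu : IsUnit (algebraMap A (Localization.AtPrime M) s) :=
      IsLocalization.map_units (M := M.primeCompl) _ ⟨s, hs⟩
    exact (Ideal.unit_mul_mem_iff_mem _ hu).1 h3
  rw [IsLocalization.algebraMap_mem_map_algebraMap_iff p.primeCompl] at h2
  obtain ⟨t, ht, h⟩ := h2
  exact ⟨t, ht, h⟩

theorem wr_order_bound {ι D K : Type*} [Finite ι] [CommRing D] [Field K] [Algebra D K]
    [Module.Flat D K] (hinj : Function.Injective (algebraMap D K))
    (x : ι → K) (hx : ∀ i, IsAlgebraic D (x i)) (p : Ideal (MvPolynomial ι D)) [p.IsPrime]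
    (hp : ∀ f, f ∈ p ↔ aeval x f = 0) (q : Ideal (MvPolynomial ι D)) [q.IsPrime] (hqp : q ≤ p) :
    ∃ c : ℕ, ∀ (m : ℕ) (g s : MvPolynomial ι D), s ∉ q → s * g ∈ q ^ (c * m) →
      ∃ t ∉ p, t * g ∈ p ^ m := by
  classical
  have := Fintype.ofFinite ι
  let M := idealOfVars ι K
  have hM : M = RingHom.ker (constantCoeff : MvPolynomial ι K →+* K) := by
    ext f; exact (wr_ker_const f).trans Iff.rfl
  have hMp : M.IsPrime := by rw [hM]; exact RingHom.ker_isPrime _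
  have hcc : ∀ f : MvPolynomial ι D, constantCoeff (wrShift x f) = aeval x f := by
    intro f
    rw [wr_shift_eq, constantCoeff_map, wr_taylor_const]; rfl
  have hpM : p = M.comap (wrShift x) := by
    ext f
    rw [Ideal.mem_comap, hp, wr_ker_const, hcc]
  have hvar : ∀ i, ∃ (c : ℕ) (s : MvPolynomial ι K), s ∉ M ∧ s * X i ^ c ∈ p.map (wrShift x) := by
    intro i
    obtain ⟨F, hF0, hF⟩ := hx i
    have hFp : Polynomial.aeval (X i : MvPolynomial ι D) F ∈ p := by
      rw [hp, ← Polynomial.aeval_algHom_apply, aeval_X, hF]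
    let G : Polynomial K := (F.map (algebraMap D K)).comp (Polynomial.X + Polynomial.C (x i))
    have hG0 : G ≠ 0 := by
      intro h0
      have h1 : F.map (algebraMap D K) = 0 := by
        have : G.comp (Polynomial.X - Polynomial.C (x i)) = F.map (algebraMap D K) := by
          simp [G, Polynomial.comp_assoc]
        rw [← this, h0, Polynomial.zero_comp]
      exact hF0 ((Polynomial.map_eq_zero_iff hinj).1 h1)
    obtain ⟨H, hH⟩ := Polynomial.exists_eq_pow_rootMultiplicity_mul_and_not_dvd G hG0 0
    obtain ⟨hGH, hnd⟩ := hH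
    rw [Polynomial.C_0, sub_zero] at hGH hnd
    have hsh : wrShift x (Polynomial.aeval (X i : MvPolynomial ι D) F) =
        Polynomial.aeval (X i : MvPolynomial ι K) G := by
      rw [Polynomial.aeval_def, Polynomial.hom_eval₂]
      simp only [G, Polynomial.aeval_def, Polynomial.eval₂_comp, Polynomial.eval₂_map]
      congr 1
      · ext r; simp [wrShift, MvPolynomial.algebraMap_eq]
      · simp [wrShift, MvPolynomial.algebraMap_eq]
    refine ⟨G.rootMultiplicity 0, Polynomial.aeval (X i : MvPolynomial ι K) H, ?_, ?_⟩
    · rw [wr_ker_const]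
      intro h
      apply hnd
      rw [Polynomial.X_dvd_iff]
      rw [Polynomial.aeval_def, Polynomial.hom_eval₂] at h
      have hid : (constantCoeff : MvPolynomial ι K →+* K).comp
          (algebraMap K (MvPolynomial ι K)) = RingHom.id K := by
        ext r; simp [MvPolynomial.algebraMap_eq]
      rw [hid] at h
      simpa [Polynomial.eval₂_id] using h
    · have := Ideal.mem_map_of_mem (wrShift x) hFp
      rw [hsh, hGH] at this
      simpa [mul_comm] using this
  choose c s hsM hs using hvar
  let N := ∑ i, c i
  let S := ∏ i, s i
  have hS : S ∉ M := by
    intro h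
    obtain ⟨i, -, hi⟩ := (hMp.prod_mem_iff).1 h
    exact hsM i hi
  have hSX : ∀ f ∈ M ^ (N + 1), S * f ∈ p.map (wrShift x) := by
    intro f hf
    change f ∈ idealOfVars ι K ^ (N + 1) at hf
    rw [pow_idealOfVars_eq_span] at hf
    induction hf using Submodule.span_induction with
    | zero => simp
    | add a b _ _ ha hb => rw [mul_add]; exact Ideal.add_mem _ ha hb
    | smul a b _ hb =>
      have : S * (a • b) = a * (S * b) := by rw [smul_eq_mul]; ring
      rw [this]; exact Ideal.mul_mem_left _ _ hb
    | mem y hy =>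
      obtain ⟨a, ha, rfl⟩ := hy
      have ha' : a.degree = N + 1 := ha
      obtain ⟨i, hi⟩ : ∃ i, c i ≤ a i := by
        by_contra! hcon
        have : a.degree ≤ N := by
          rw [Finsupp.degree_eq_sum]
          exact Finset.sum_le_sum fun i _ => (hcon i).le
        omega
      have h1 : s i * X i ^ c i ∣ S * monomial a (1 : K) := by
        refine mul_dvd_mul (Finset.dvd_prod_of_mem s (Finset.mem_univ i)) ?_
        rw [X_pow_eq_monomial, monomial_dvd_monomial]
        exact ⟨Or.inr (by simpa using hi), one_dvd _⟩
      exact Ideal.mem_of_dvd _ h1 (hs i)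
  refine ⟨N + 1, fun m g s₀ hs₀ hg => ?_⟩
  refine wr_descend (wrShift x) (wr_shift_flat x) M p hpM (p ^ m) g (S ^ m)
    (fun h => hS (hMp.mem_of_pow_mem _ h)) ?_
  have hgM : wrShift x g ∈ (M ^ (N + 1)) ^ m := by
    rw [← pow_mul, mem_pow_idealOfVars_iff']
    intro a ha
    rw [wr_shift_eq, coeff_map]
    exact (hp _).1 (hqp (wr_taylor_coeff q g s₀ _ hs₀ hg a ha))
  have hle : Ideal.span {S} * M ^ (N + 1) ≤ p.map (wrShift x) := by
    rw [Ideal.span_singleton_mul_le_iff]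
    exact hSX
  rw [Ideal.map_pow]
  refine Ideal.pow_right_mono hle m ?_
  rw [mul_pow, Ideal.span_singleton_pow]
  exact Ideal.mul_mem_mul (Ideal.mem_span_singleton_self _) hgM

theorem wr_flat_of_injective {D K : Type*} [CommRing D] [Field K] [Algebra D K]
    (hinj : Function.Injective (algebraMap D K)) : Module.Flat D K := by
  have : IsDomain D := hinj.isDomain _
  have : FaithfulSMul D K := (faithfulSMul_iff_algebraMap_injective D K).2 hinj
  let _ : Algebra (FractionRing D) K := FractionRing.liftAlgebra D K
  have : IsScalarTower D (FractionRing D) K := FractionRing.isScalarTower_liftAlgebra D K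
  have : Module.Flat D (FractionRing D) := IsLocalization.flat _ (nonZeroDivisors D)
  exact Module.Flat.trans D (FractionRing D) K

theorem wr_zariski_nagata_aux {σ k K : Type*} [Finite σ] [Field k] [Field K] [Algebra k K]
    (p q : Ideal (MvPolynomial σ k)) (hp : p.IsPrime) (hq : q.IsPrime) (hqp : q ≤ p)
    (x : σ → K) (hxp : ∀ f : MvPolynomial σ k, f ∈ p ↔ aeval x f = 0) :
    ∃ c : ℕ, ∀ (m : ℕ) (g s : MvPolynomial σ k), s ∉ q → s * g ∈ q ^ (c * m) →
      ∃ t ∉ p, t * g ∈ p ^ m := by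
  classical
  obtain ⟨B, hB⟩ := (Set.toFinite {B : Set σ | AlgebraicIndepOn k x B}).exists_maximal
    ⟨∅, algebraicIndependent_empty_type⟩
  have hBi : AlgebraicIndepOn k x B := hB.1
  let _ : Algebra (MvPolynomial B k) K := (aeval (fun i : B => x i)).toRingHom.toAlgebra
  have hmap : ∀ f, algebraMap (MvPolynomial B k) K f = aeval (fun i : B => x i) f := fun f => rfl
  have hinj : Function.Injective (algebraMap (MvPolynomial B k) K) := hBi
  have hflat : Module.Flat (MvPolynomial B k) K := wr_flat_of_injective hinj
  have halg : ∀ i : (Bᶜ : Set σ), IsAlgebraic (MvPolynomial B k) (x i) := by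
    intro i
    by_contra htr
    have htr' : Transcendental (Algebra.adjoin k (x '' B)) (x i) := by
      intro h
      apply htr
      refine IsAlgebraic.of_ringHom_of_comp_eq
        (S := Algebra.adjoin k (x '' B)) (B := K) (hBi.aevalEquiv : _ →+* _) (RingHom.id K) h
        hBi.aevalEquiv.surjective Function.injective_id ?_
      ext f
      · have h5 := AlgebraicIndependent.algebraMap_aevalEquiv (x := fun i : B => x i) hBi (C f)
        rw [aeval_C] at h5
        simp only [RingHom.comp_apply, hmap, aeval_C]
        exact h5
      · have h5 := AlgebraicIndependent.algebraMap_aevalEquiv (x := fun i : B => x i) hBi (X f)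
        rw [aeval_X] at h5
        simp only [RingHom.comp_apply, hmap, aeval_X]
        exact h5
    have h2 : AlgebraicIndepOn k x (insert i.1 B) := hBi.insert htr'
    exact i.2 (hB.2 h2 (Set.subset_insert _ _) (Set.mem_insert _ _))
  let e : MvPolynomial σ k ≃ₐ[k] MvPolynomial (Bᶜ : Set σ) (MvPolynomial B k) :=
    (renameEquiv k ((Equiv.Set.sumCompl B).symm.trans (Equiv.sumComm _ _))).trans
      (sumAlgEquiv k (Bᶜ : Set σ) B)
  let ee : MvPolynomial σ k →+* MvPolynomial (Bᶜ : Set σ) (MvPolynomial B k) := e.toRingEquiv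
  let es : MvPolynomial (Bᶜ : Set σ) (MvPolynomial B k) →+* MvPolynomial σ k := e.symm.toRingEquiv
  have hse : ∀ f, es (e f) = f := fun f => e.symm_apply_apply f
  have hee : ∀ f, ee f = e f := fun f => rfl
  let x' : (Bᶜ : Set σ) → K := fun i => x i
  have he : ∀ f, aeval x' (e f) = aeval x f := by
    intro f
    have : ((aeval x' : MvPolynomial (Bᶜ : Set σ) (MvPolynomial B k) →ₐ[MvPolynomial B k] K).toRingHom).comp
        ee = (aeval x : MvPolynomial σ k →ₐ[k] K).toRingHom := by
      apply MvPolynomial.ringHom_ext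
      · intro r; simp [hee, e, hmap]
      · intro i
        by_cases hi : i ∈ B
        · simp [hee, e, Equiv.Set.sumCompl_symm_apply_of_mem hi, hmap]
        · simp [hee, e, Equiv.Set.sumCompl_symm_apply_of_notMem hi, x']
    exact (DFunLike.congr_fun this f)
  let p' := p.comap es
  let q' := q.comap es
  have hmem : ∀ (J : Ideal (MvPolynomial σ k)) (m : ℕ) (f : MvPolynomial σ k),
      e f ∈ (J.comap es) ^ m ↔ f ∈ J ^ m := by
    intro J m f
    have h1 : J.comap es = J.map ee :=
      (Ideal.map_comap_of_equiv e.toRingEquiv).symm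
    rw [h1, ← Ideal.map_pow]
    constructor
    · intro h
      have := Ideal.mem_map_of_mem es h
      rw [Ideal.map_map] at this
      have hid : es.comp ee =
        RingHom.id _ := RingHom.ext hse
      rw [hid, Ideal.map_id] at this
      rwa [hse] at this
    · exact fun h => Ideal.mem_map_of_mem _ h
  have hmem1 : ∀ (J : Ideal (MvPolynomial σ k)) (f : MvPolynomial σ k),
      e f ∈ (J.comap es) ↔ f ∈ J := by
    intro J f
    rw [Ideal.mem_comap, hse]
  obtain ⟨c, hc⟩ := wr_order_bound hinj x' halg p' (by
    intro f
    obtain ⟨f, rfl⟩ := e.surjective f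
    rw [he, hmem1, hxp]) q' (Ideal.comap_mono hqp)
  refine ⟨c, fun m g s hs hg => ?_⟩
  obtain ⟨t, ht, htg⟩ := hc m (e g) (e s) (by rwa [hmem1]) (by
    rw [← map_mul, hmem]; exact hg)
  obtain ⟨t, rfl⟩ := e.surjective t
  exact ⟨t, by rwa [hmem1] at ht, by rwa [← map_mul, hmem] at htg⟩

theorem wr_zariski_nagata {σ k : Type*} [Finite σ] [Field k] (p q : Ideal (MvPolynomial σ k))
    (hp : p.IsPrime) (hq : q.IsPrime) (hqp : q ≤ p) :
    ∃ c : ℕ, ∀ (m : ℕ) (g s : MvPolynomial σ k), s ∉ q → s * g ∈ q ^ (c * m) →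
      ∃ t ∉ p, t * g ∈ p ^ m := by
  let K := FractionRing (MvPolynomial σ k ⧸ p)
  let x : σ → K := fun i => algebraMap (MvPolynomial σ k ⧸ p) K (Ideal.Quotient.mk p (X i))
  have hx : ∀ f : MvPolynomial σ k, aeval x f =
      algebraMap (MvPolynomial σ k ⧸ p) K (Ideal.Quotient.mk p f) := by
    intro f
    have : (aeval x : MvPolynomial σ k →ₐ[k] K) =
        (IsScalarTower.toAlgHom k (MvPolynomial σ k ⧸ p) K).comp (Ideal.Quotient.mkₐ k p) := by
      ext i; simp [x]
    exact (DFunLike.congr_fun this f)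
  have hxp : ∀ f : MvPolynomial σ k, f ∈ p ↔ aeval x f = 0 := by
    intro f
    rw [hx, FaithfulSMul.algebraMap_eq_zero_iff, Ideal.Quotient.eq_zero_iff_mem]
  exact wr_zariski_nagata_aux p q hp hq hqp x hxp

end

section
open LaurentPolynomial

/-- Laurent polynomials whose coefficient in degree `n` lies in `I ^ n`. -/
noncomputable def wrRees {R : Type*} [CommRing R] (I : Ideal R) :
    Subalgebra R (LaurentPolynomial R) where
  carrier := {f | ∀ n : ℤ, f.coeff n ∈ I ^ n.toNat}
  mul_mem' := by
    classical
    intro f g hf hg n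
    rw [AddMonoidAlgebra.coeff_mul]
    refine Ideal.sum_mem _ fun a _ => Ideal.sum_mem _ fun b _ => ?_
    dsimp only
    split_ifs with h
    · have h1 := Ideal.mul_mem_mul (hf a) (hg b)
      rw [← pow_add] at h1
      exact Ideal.pow_le_pow_right (by omega) h1
    · exact Ideal.zero_mem _
  add_mem' := by
    intro f g hf hg n
    exact Ideal.add_mem _ (hf n) (hg n)
  algebraMap_mem' := by
    intro r n
    rw [← LaurentPolynomial.C_eq_algebraMap, LaurentPolynomial.C_apply]
    split_ifs with h
    · subst h; simp
    · exact Ideal.zero_mem _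

theorem wr_swanson {R : Type*} [CommRing R] [IsNoetherianRing R] (I : Ideal R)
    (hZN : ∀ p q : Ideal R, p.IsPrime → q.IsPrime → q ≤ p →
      ∃ c : ℕ, ∀ (m : ℕ) (g s : R), s ∉ q → s * g ∈ q ^ (c * m) → ∃ t ∉ p, t * g ∈ p ^ m) :
    ∃ N : ℕ, ∀ r m : ℕ, N * r ≤ m → symbolicPower I m ≤ I ^ r := by
  classical
  obtain ⟨G, hG⟩ := (inferInstance : IsNoetherianRing R).noetherian I
  let gens : Finset (LaurentPolynomial R) :=
    insert (T (-1)) (G.image fun a => LaurentPolynomial.C a * T 1)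
  let B : Subalgebra R (LaurentPolynomial R) := Algebra.adjoin R (gens : Set (LaurentPolynomial R))
  have hBfg : B.FG := ⟨gens, rfl⟩
  have hBft : Algebra.FiniteType R B := B.fg_iff_finiteType.1 hBfg
  have hBN : IsNoetherianRing B := Algebra.FiniteType.isNoetherianRing R B
  have hu : T (-1) ∈ B := Algebra.subset_adjoin (by simp [gens])
  have hle : B ≤ wrRees I := by
    refine Algebra.adjoin_le ?_
    intro f hf n
    simp only [gens, Finset.coe_insert, Finset.coe_image, Set.mem_insert_iff, Set.mem_image,
      Finset.mem_coe] at hf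
    rcases hf with rfl | ⟨a, ha, rfl⟩
    · rw [T_apply]
      split_ifs with h
      · subst h; simp
      · exact Ideal.zero_mem _
    · rw [← single_eq_C_mul_T, AddMonoidAlgebra.coeff_single, Finsupp.single_apply]
      split_ifs with h
      · subst h
        have : a ∈ I := hG ▸ Submodule.subset_span ha
        simpa using this
      · exact Ideal.zero_mem _
  have haT : ∀ a ∈ I, LaurentPolynomial.C a * T 1 ∈ B := by
    intro a ha
    rw [← hG] at ha
    induction ha using Submodule.span_induction with
    | mem x hx =>
      exact Algebra.subset_adjoin (by simpa [gens] using Or.inr ⟨x, hx, rfl⟩)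
    | zero => simp
    | add x y _ _ hx hy => rw [map_add, add_mul]; exact B.add_mem hx hy
    | smul r x _ hx =>
      rw [smul_eq_mul, map_mul, mul_assoc, ← smul_eq_C_mul]
      exact B.smul_mem hx r
  let u : B := ⟨T (-1), hu⟩
  have hunz : u ∈ nonZeroDivisors B := by
    rw [mem_nonZeroDivisors_iff_right]
    intro z hz
    have h1 : (z : LaurentPolynomial R) * T (-1) = 0 := congr_arg Subtype.val hz
    exact Subtype.ext ((isUnit_T (R := R) (-1)).mul_left_eq_zero.1 h1)
  obtain ⟨PS, hPS, K, hK⟩ := wr_principal u hunz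
  have hex : ∀ P : PS, ∃ c : ℕ, ∀ (m : ℕ) (g : R), g ∈ symbolicPower I (c * m) →
      ∃ t ∉ P.1.comap (algebraMap R B), t * g ∈ (P.1.comap (algebraMap R B)) ^ m := by
    intro P
    have hPp : P.1.IsPrime := (hPS P.1 P.2).1
    have hIp : I ≤ P.1.comap (algebraMap R B) := by
      intro a ha
      rw [Ideal.mem_comap]
      have : algebraMap R B a = u * ⟨_, haT a ha⟩ := by
        apply Subtype.ext
        change algebraMap R (LaurentPolynomial R) a = T (-1) * (LaurentPolynomial.C a * T 1)
        rw [← C_eq_algebraMap, T_mul, mul_T_assoc]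
        simp
      rw [this]
      exact Ideal.mul_mem_right _ _ (hPS P.1 P.2).2
    obtain ⟨q, hq, hqp⟩ := Ideal.exists_minimalPrimes_le hIp
    obtain ⟨c, hc⟩ := hZN _ q (hPp.comap _) hq.1.1 hqp
    refine ⟨c, fun m g hg => ?_⟩
    obtain ⟨s, hs, hsg⟩ := hg q hq
    exact hc m g s hs (Ideal.pow_right_mono hq.1.2 _ hsg)
  choose c hc using hex
  let N := ∑ P, c P
  have hcN : ∀ P, c P ≤ N := fun P =>
    Finset.single_le_sum (fun _ _ => Nat.zero_le _) (Finset.mem_univ P)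
  refine ⟨N * K, fun r m hm g hg => ?_⟩
  obtain ⟨b, hb⟩ := hK r (algebraMap R B g) (by
    intro P hP
    obtain ⟨t, ht, htg⟩ := hc ⟨P, hP⟩ (K * r) g (by
      intro q hq
      obtain ⟨s, hs, hsg⟩ := hg q hq
      refine ⟨s, hs, Ideal.pow_le_pow_right (le_trans ?_ hm) hsg⟩
      rw [mul_assoc]
      exact Nat.mul_le_mul_right _ (hcN _))
    refine ⟨algebraMap R B t, ht, ?_⟩
    rw [← map_mul]
    have h1 := Ideal.mem_map_of_mem (algebraMap R B) htg
    rw [Ideal.map_pow] at h1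
    exact Ideal.pow_right_mono Ideal.map_comap_le _ h1)
  have hb' : LaurentPolynomial.C g = T (-1) ^ r * (b : LaurentPolynomial R) := congr_arg Subtype.val hb
  have h2 : (b : LaurentPolynomial R) = LaurentPolynomial.C g * T r := by
    rw [hb', T_pow, T_mul, mul_T_assoc]
    simp
  have h3 := hle b.2 (r : ℤ)
  rw [h2, ← single_eq_C_mul_T, AddMonoidAlgebra.coeff_single, Finsupp.single_eq_same] at h3
  simpa using h3
end

section
open MvPolynomial

theorem wr_mem_of_le_symbolic {R : Type*} [CommRing R] (I : Ideal R) (n : ℕ) :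
    I ^ n ≤ symbolicPower I n := by
  intro x hx q hq
  exact ⟨1, fun h => hq.1.1.ne_top ((Ideal.eq_top_iff_one q).2 h), by simpa using hx⟩

theorem wr_pow_mem_symbolic {R : Type*} [CommRing R] (I : Ideal R) (m : ℕ) (x : R)
    (hx : x ∈ symbolicPower I m) (n : ℕ) : x ^ n ∈ symbolicPower I (n * m) := by
  induction n with
  | zero => rw [zero_mul]; exact mem_symbolicPower_zero I _
  | succ n ih =>
    rw [pow_succ, add_mul, one_mul]
    exact symbolicPower_mul_mem I ih hx

/-- Elements of the `n`-th symbolic power vanish to order `n` at the origin. -/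
theorem wr_symbolic_le {σ k : Type*} [Field k] (I : Ideal (MvPolynomial σ k))
    (hI : I ≤ idealOfVars σ k) (n : ℕ) : symbolicPower I n ≤ idealOfVars σ k ^ n := by
  have hM : idealOfVars σ k = RingHom.ker (constantCoeff : MvPolynomial σ k →+* k) := by
    ext f; rw [wr_ker_const, RingHom.mem_ker]
  have hprime : (idealOfVars σ k).IsPrime := by rw [hM]; exact RingHom.ker_isPrime _
  obtain ⟨q, hq, hqM⟩ := Ideal.exists_minimalPrimes_le hI
  intro g hg
  obtain ⟨s, hs, hsg⟩ := hg q hq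
  have hqp : q.IsPrime := hq.1.1
  rw [mem_pow_idealOfVars_iff']
  intro a ha
  have h1 := hqM (wr_taylor_coeff q g s n hs (Ideal.pow_right_mono hq.1.2 _ hsg) a ha)
  rw [wr_ker_const] at h1
  have h2 : (map constantCoeff).comp (wrTaylor σ k) = RingHom.id (MvPolynomial σ k) := by
    ext i <;> simp [wrTaylor]
  have h3 : map constantCoeff (wrTaylor σ k g) = g := (DFunLike.congr_fun h2 g)
  rw [← h3, coeff_map]
  exact h1

theorem wr_degree_ge {σ k : Type*} [Field k] (g : MvPolynomial σ k) (n e : ℕ) (hg : g ≠ 0)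
    (he : g.IsHomogeneous e) (h : g ∈ idealOfVars σ k ^ n) : n ≤ e := by
  by_contra hlt
  apply hg
  rw [mem_pow_idealOfVars_iff'] at h
  ext a
  rw [coeff_zero]
  by_contra hc
  have h1 := he hc
  have h2 : a.degree = e := by
    rw [Finsupp.degree_eq_weight_one]
    exact h1
  exact hc (h a (by omega))

variable {k : Type*} [Field k] {d : ℕ}

theorem wr_alpha_spec (J : Ideal (MvPolynomial (Fin d) k)) (f : MvPolynomial (Fin d) k) (e : ℕ)
    (hf : f ∈ J) (hf0 : f ≠ 0) (he : f.IsHomogeneous e) :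
    alphaDeg J ≤ e ∧ ∃ g ∈ J, g ≠ 0 ∧ g.IsHomogeneous (alphaDeg J) :=
  ⟨Nat.sInf_le ⟨f, hf, hf0, he⟩,
    Nat.sInf_mem (s := {n : ℕ | ∃ f ∈ J, f ≠ 0 ∧ f.IsHomogeneous n}) ⟨e, f, hf, hf0, he⟩⟩

theorem wr_component_mem (I : Ideal (MvPolynomial (Fin d) k))
    (hhom : I.IsHomogeneous (MvPolynomial.homogeneousSubmodule (Fin d) k))
    (f : MvPolynomial (Fin d) k) (hf : f ∈ I) (i : ℕ) : homogeneousComponent i f ∈ I := by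
  have h := hhom i hf
  have h1 := MvPolynomial.decomposition.decompose'_apply f i
  rw [← h1]
  exact h

theorem wr_le_vars_pow (I : Ideal (MvPolynomial (Fin d) k))
    (hhom : I.IsHomogeneous (MvPolynomial.homogeneousSubmodule (Fin d) k)) :
    I ≤ idealOfVars (Fin d) k ^ alphaDeg I := by
  intro f hf
  rw [mem_pow_idealOfVars_iff']
  intro a ha
  by_contra hc
  have h1 : coeff a (homogeneousComponent a.degree f) = coeff a f := by
    rw [coeff_homogeneousComponent, if_pos rfl]
  have h2 : homogeneousComponent a.degree f ≠ 0 := by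
    intro h; rw [h, coeff_zero] at h1; exact hc h1.symm
  have := (wr_alpha_spec I _ _ (wr_component_mem I hhom f hf _) h2
    (homogeneousComponent_isHomogeneous _ _)).1
  omega

theorem wr_exists_homogeneous (I : Ideal (MvPolynomial (Fin d) k)) (hne : I ≠ ⊥)
    (hhom : I.IsHomogeneous (MvPolynomial.homogeneousSubmodule (Fin d) k)) :
    ∃ f ∈ I, f ≠ 0 ∧ f.IsHomogeneous (alphaDeg I) := by
  obtain ⟨f, hf, hf0⟩ := Submodule.exists_mem_ne_zero_of_ne_bot hne
  obtain ⟨a, ha⟩ := ne_zero_iff.1 hf0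
  have h1 : coeff a (homogeneousComponent a.degree f) = coeff a f := by
    rw [coeff_homogeneousComponent, if_pos rfl]
  have h2 : homogeneousComponent a.degree f ≠ 0 := by
    intro h; rw [h, coeff_zero] at h1; exact ha h1.symm
  exact (wr_alpha_spec I _ _ (wr_component_mem I hhom f hf _) h2
    (homogeneousComponent_isHomogeneous _ _)).2

theorem wr_alpha_pos (I : Ideal (MvPolynomial (Fin d) k)) (hne : I ≠ ⊥) (hproper : I ≠ ⊤)
    (hhom : I.IsHomogeneous (MvPolynomial.homogeneousSubmodule (Fin d) k)) : 0 < alphaDeg I := by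
  obtain ⟨f, hf, hf0, hfh⟩ := wr_exists_homogeneous I hne hhom
  by_contra h0
  have h0 : alphaDeg I = 0 := by omega
  rw [h0] at hfh
  have hc : f = C (coeff 0 f) := totalDegree_eq_zero_iff_eq_C.1 (by
    have := hfh.totalDegree_le; omega)
  apply hproper
  refine Ideal.eq_top_of_isUnit_mem _ hf ?_
  rw [hc]
  refine IsUnit.map C (isUnit_iff_ne_zero.2 fun h => hf0 ?_)
  rw [hc, h, C_0]

theorem wr_asymptotic (α a m : ℕ) (ρ : ℝ) (hα : 0 < α) (hρ : 0 ≤ ρ)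
    (h : ∀ n r : ℕ, 0 < n → 0 < r → n * a < r * α → ((n * m : ℕ) : ℝ) / r ≤ ρ) :
    (α : ℝ) * m ≤ ρ * a := by
  by_contra hlt
  push Not at hlt
  obtain ⟨n, hn⟩ := exists_nat_gt (ρ * α / ((α : ℝ) * m - ρ * a))
  have hpos : 0 < (α : ℝ) * m - ρ * a := by linarith
  have hα' : (0 : ℝ) < α := by exact_mod_cast hα
  have hn0 : (0 : ℝ) < n := lt_of_le_of_lt (by positivity) hn
  have h1 := h n (n * a / α + 1) (by exact_mod_cast hn0) (Nat.succ_pos _) (by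
    have := Nat.lt_div_mul_add (a := n * a) hα
    rw [add_mul, one_mul]; exact this)
  have hr : (0 : ℝ) < ((n * a / α + 1 : ℕ) : ℝ) := by positivity
  rw [div_le_iff₀ hr] at h1
  rw [div_lt_iff₀ hpos] at hn
  have h2 : ((n * a / α + 1 : ℕ) : ℝ) * α ≤ n * a + α := by
    have : (n * a / α + 1) * α ≤ n * a + α := by
      rw [add_mul, one_mul]; exact Nat.add_le_add_right (Nat.div_mul_le_self _ _) _
    exact_mod_cast this
  push_cast at h1 h2
  have h3 : (n : ℝ) * m * α ≤ ρ * (n * a + α) := by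
    calc (n : ℝ) * m * α ≤ ρ * (((n * a / α : ℕ) : ℝ) + 1) * α := by
          exact mul_le_mul_of_nonneg_right h1 hα'.le
      _ = ρ * ((((n * a / α : ℕ) : ℝ) + 1) * α) := by ring
      _ ≤ _ := mul_le_mul_of_nonneg_left h2 hρ
  nlinarith
end

/-- **Bocci–Harbourne, Lemma 2.3.2.** For a nonzero proper homogeneous radical ideal
`I` of `k[X_0, …, X_d]` one has `γ(I) ≥ 1`, `γ(I) ≤ α(I)` and
`1 ≤ α(I)/γ(I) ≤ ρ(I)`. -/
theorem waldschmidt_resurgence_bounds (k : Type*) [Field k] (d : ℕ)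
    (I : Ideal (MvPolynomial (Fin (d + 1)) k))
    (hne : I ≠ ⊥) (hproper : I ≠ ⊤) (hrad : I.radical = I)
    (hhom : I.IsHomogeneous (MvPolynomial.homogeneousSubmodule (Fin (d + 1)) k)) :
    1 ≤ waldschmidt I ∧ waldschmidt I ≤ (alphaDeg I : ℝ) ∧
      (alphaDeg I : ℝ) / waldschmidt I ≤ resurgence I ∧
      1 ≤ (alphaDeg I : ℝ) / waldschmidt I := by
  have hα := wr_alpha_pos I hne hproper hhom
  obtain ⟨f, hf, hf0, hfh⟩ := wr_exists_homogeneous I hne hhom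
  have hIα := wr_le_vars_pow I hhom
  have hIv : I ≤ MvPolynomial.idealOfVars (Fin (d + 1)) k :=
    hIα.trans (Ideal.pow_le_self hα.ne')
  have hat : ∀ n, ∃ g ∈ symbolicPower I n, g ≠ 0 ∧
      g.IsHomogeneous (alphaDeg (symbolicPower I n)) := fun n =>
    (wr_alpha_spec (symbolicPower I n) (f ^ n) _
      (wr_mem_of_le_symbolic I n (Ideal.pow_mem_pow hf n)) (pow_ne_zero n hf0) (hfh.pow n)).2
  have hge : ∀ n, n ≤ alphaDeg (symbolicPower I n) := by
    intro n
    obtain ⟨g, hg, hg0, hgh⟩ := hat n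
    exact wr_degree_ge g n _ hg0 hgh (wr_symbolic_le I hIv n hg)
  have hγ1 : 1 ≤ waldschmidt I := by
    refine le_csInf ⟨_, 1, one_pos, rfl⟩ ?_
    rintro x ⟨n, hn, rfl⟩
    rw [le_div_iff₀ (by exact_mod_cast hn), one_mul]
    exact_mod_cast hge n
  have hγα : waldschmidt I ≤ (alphaDeg I : ℝ) := by
    have h1 : waldschmidt I ≤ (alphaDeg (symbolicPower I 1) : ℝ) / (1 : ℕ) := by
      refine csInf_le ⟨0, ?_⟩ ⟨1, one_pos, rfl⟩
      rintro x ⟨n, hn, rfl⟩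
      positivity
    have h2 : alphaDeg (symbolicPower I 1) ≤ alphaDeg I :=
      (wr_alpha_spec (symbolicPower I 1) f _
        (wr_mem_of_le_symbolic I 1 (by rwa [pow_one])) hf0 hfh).1
    refine h1.trans ?_
    rw [Nat.cast_one, div_one]
    exact_mod_cast h2
  have hγ0 : 0 < waldschmidt I := lt_of_lt_of_le one_pos hγ1
  obtain ⟨N, hN⟩ := wr_swanson I (fun p q hp hq hqp => wr_zariski_nagata p q hp hq hqp)
  have hbdd : BddAbove {x : ℝ | ∃ m r : ℕ, 0 < m ∧ 0 < r ∧ ¬ symbolicPower I m ≤ I ^ r ∧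
      x = (m : ℝ) / r} := by
    refine ⟨N, ?_⟩
    rintro x ⟨m, r, hm, hr, hmr, rfl⟩
    by_contra hlt
    push Not at hlt
    rw [lt_div_iff₀ (by exact_mod_cast hr)] at hlt
    exact hmr (hN r m (by exact_mod_cast hlt.le))
  have hρ0 : 0 ≤ resurgence I := by
    refine Real.sSup_nonneg ?_
    rintro x ⟨m, r, hm, hr, hmr, rfl⟩
    positivity
  have key : ∀ m, 0 < m →
      (alphaDeg I : ℝ) * m ≤ resurgence I * alphaDeg (symbolicPower I m) := by
    intro m hm
    refine wr_asymptotic _ _ m _ hα hρ0 ?_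
    intro n r hn hr hlt
    refine le_csSup hbdd ⟨n * m, r, Nat.mul_pos hn hm, hr, ?_, rfl⟩
    intro hle
    obtain ⟨g, hg, hg0, hgh⟩ := hat m
    have h1 := hle (wr_pow_mem_symbolic I m g hg n)
    have h2 := Ideal.pow_right_mono hIα r h1
    rw [← pow_mul] at h2
    have h3 := wr_degree_ge (g ^ n) _ _ (pow_ne_zero n hg0) (hgh.pow n) h2
    rw [mul_comm, mul_comm _ n] at h3
    omega
  have hρpos : 0 < resurgence I := by
    have h1 := key 1 one_pos
    rcases hρ0.lt_or_eq with h | h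
    · exact h
    · rw [← h, zero_mul, Nat.cast_one, mul_one] at h1
      have : (0 : ℝ) < alphaDeg I := by exact_mod_cast hα
      linarith
  have hγρ : (alphaDeg I : ℝ) / resurgence I ≤ waldschmidt I := by
    refine le_csInf ⟨_, 1, one_pos, rfl⟩ ?_
    rintro x ⟨n, hn, rfl⟩
    rw [div_le_div_iff₀ hρpos (by exact_mod_cast hn), mul_comm _ (resurgence I)]
    exact key n hn
  refine ⟨hγ1, hγα, ?_, ?_⟩
  · rw [div_le_iff₀ hγ0]
    rw [div_le_iff₀ hρpos, mul_comm] at hγρ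
    exact hγρ
  · rw [le_div_iff₀ hγ0, one_mul]
    exact hγα
end

section
/- Let k be an algebraically closed field of characteristic zero, let p be a prime ideal of R = k[X_1,…,X_d], and let n be a positive integer. Then the n-th symbolic power of p equals the n-th differential power: p^{(n)} = { f ∈ R : for every multi-index (e_1,…,e_d) of nonnegative integers with e_1 + ⋯ + e_d ≤ n−1, the iterated partial derivative ∂^{e_1}_{X_1} ⋯ ∂^{e_d}_{X_d} f lies in p }. -/
/-- The iterated partial derivative `∂^{e 0}_{X 0} ⋯ ∂^{e (d-1)}_{X (d-1)} f` of a
multivariate polynomial. -/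
noncomputable def iterPDeriv {k : Type*} [CommSemiring k] {d : ℕ} (e : Fin d → ℕ)
    (f : MvPolynomial (Fin d) k) : MvPolynomial (Fin d) k :=
  (((List.finRange d).map fun i =>
      (MvPolynomial.pderiv (R := k) i :
          Module.End k (MvPolynomial (Fin d) k)) ^ e i).prod) f

theorem zn_mem_iff {R : Type*} [CommRing R] (p : Ideal R) [p.IsPrime] (n : ℕ) (x : R) :
    x ∈ symbolicPower p n ↔ ∃ s ∉ p, s * x ∈ p ^ n := by
  rw [mem_symbolicPower_iff, Ideal.minimalPrimes_eq_subsingleton_self]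
  simp

theorem zn_pow_le {R : Type*} [CommRing R] (p : Ideal R) [p.IsPrime] (n : ℕ) {x : R}
    (hx : x ∈ p ^ n) : x ∈ symbolicPower p n :=
  (zn_mem_iff p n x).2 ⟨1, p.one_notMem, by simpa using hx⟩

theorem zn_cancel {R : Type*} [CommRing R] (p : Ideal R) [p.IsPrime] (n : ℕ) {x t : R}
    (ht : t ∉ p) (hx : t * x ∈ symbolicPower p n) : x ∈ symbolicPower p n := by
  rw [zn_mem_iff] at hx ⊢
  obtain ⟨s, hs, h⟩ := hx
  exact ⟨s * t, fun h' => (Ideal.IsPrime.mem_or_mem ‹_› h').elim hs ht, by rwa [mul_assoc]⟩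

theorem zn_one {R : Type*} [CommRing R] (p : Ideal R) [p.IsPrime] {x : R} :
    x ∈ symbolicPower p 1 ↔ x ∈ p := by
  constructor
  · rw [zn_mem_iff]
    rintro ⟨s, hs, h⟩
    rw [pow_one] at h
    exact (Ideal.IsPrime.mem_or_mem ‹_› h).resolve_left hs
  · intro h
    exact zn_pow_le p 1 (by simpa using h)

theorem zn_mono {R : Type*} [CommRing R] (p : Ideal R) [p.IsPrime] {m n : ℕ} (h : m ≤ n) {x : R}
    (hx : x ∈ symbolicPower p n) : x ∈ symbolicPower p m := by
  rw [zn_mem_iff] at hx ⊢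
  obtain ⟨s, hs, hh⟩ := hx
  exact ⟨s, hs, Ideal.pow_le_pow_right h hh⟩

section poly
open MvPolynomial

theorem zn_deriv_pow {k R : Type*} [CommRing k] [CommRing R] [Algebra k R] (D : Derivation k R R)
    (p : Ideal R) (n : ℕ) : ∀ x ∈ p ^ (n + 1), D x ∈ p ^ n := by
  induction n with
  | zero => intro x _; simp
  | succ n ih =>
    intro x hx
    rw [pow_succ] at hx
    induction hx using Submodule.mul_induction_on' with
    | mem_mul_mem a ha b hb =>
      rw [D.leibniz, smul_eq_mul, smul_eq_mul]
      refine Ideal.add_mem _ (Ideal.mul_mem_right _ _ ha) ?_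
      rw [pow_succ']
      exact Ideal.mul_mem_mul hb (ih a ha)
    | add a _ b _ ha hb => rw [map_add]; exact Ideal.add_mem _ ha hb

theorem zn_deriv {k R : Type*} [CommRing k] [CommRing R] [Algebra k R] (D : Derivation k R R)
    (p : Ideal R) [p.IsPrime] (n : ℕ) {x : R} (hx : x ∈ symbolicPower p (n + 1)) :
    D x ∈ symbolicPower p n := by
  obtain ⟨s, hs, h⟩ := (zn_mem_iff p _ x).1 hx
  have h1 := zn_deriv_pow D p n _ h
  rw [D.leibniz, smul_eq_mul, smul_eq_mul] at h1
  refine zn_cancel p n hs ?_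
  have h2 : s * D x = (s * D x + x * D s) - D s * x := by ring
  rw [h2]
  exact Ideal.sub_mem _ (zn_pow_le p n h1)
    (Ideal.mul_mem_left _ _ (zn_mono p (Nat.le_succ n) hx))

theorem zn_commute {k : Type*} [CommRing k] {d : ℕ} (i j : Fin d) :
    Commute (MvPolynomial.pderiv (R := k) i : Module.End k (MvPolynomial (Fin d) k))
      (MvPolynomial.pderiv (R := k) j : Module.End k (MvPolynomial (Fin d) k)) := by
  have h : ⁅(pderiv i : Derivation k (MvPolynomial (Fin d) k) (MvPolynomial (Fin d) k)),
      (pderiv j : Derivation k (MvPolynomial (Fin d) k) (MvPolynomial (Fin d) k))⁆ = 0 := by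
    apply MvPolynomial.derivation_ext
    intro l
    rw [Derivation.commutator_apply]
    simp [pderiv_X, Pi.single_apply, apply_ite]
  refine LinearMap.ext fun x => ?_
  have := congrArg (fun D => D x) h
  simp only [Derivation.commutator_apply, Derivation.coe_zero, Pi.zero_apply, sub_eq_zero] at this
  simpa using this

theorem zn_list_prod {M ι : Type*} [Monoid M] (D : ι → M) (hD : ∀ i j, Commute (D i) (D j))
    (e e' : ι → ℕ) (l : List ι) :
    (l.map fun i => D i ^ (e i + e' i)).prod =
      (l.map fun i => D i ^ e i).prod * (l.map fun i => D i ^ e' i).prod := by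
  induction l with
  | nil => simp
  | cons a l ih =>
    simp only [List.map_cons, List.prod_cons]
    rw [ih, pow_add]
    have : Commute (D a ^ e' a) (l.map fun i => D i ^ e i).prod := by
      apply Commute.list_prod_right
      intro x hx
      obtain ⟨i, _, rfl⟩ := List.mem_map.1 hx
      exact (hD a i).pow_pow _ _
    simp only [mul_assoc]
    rw [← mul_assoc (D a ^ e' a), this.eq]
    simp only [mul_assoc]

theorem zn_list_single {M ι : Type*} [Monoid M] [DecidableEq ι] (D : ι → M) (j : ι)
    (l : List ι) (hl : l.Nodup) :
    (l.map fun i => D i ^ (Pi.single j 1 : ι → ℕ) i).prod = if j ∈ l then D j else 1 := by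
  induction l with
  | nil => simp
  | cons a l ih =>
    rw [List.nodup_cons] at hl
    rw [List.map_cons, List.prod_cons, ih hl.2]
    by_cases h : a = j
    · subst h
      simp [hl.1]
    · simp [h, Ne.symm h]

theorem zn_iter_succ {k : Type*} [CommRing k] {d : ℕ} (e : Fin d → ℕ) (j : Fin d)
    (f : MvPolynomial (Fin d) k) :
    iterPDeriv (e + Pi.single j 1) f = iterPDeriv e (pderiv j f) := by
  unfold iterPDeriv
  simp only [Pi.add_apply]
  rw [zn_list_prod _ zn_commute, zn_list_single _ _ _ (List.nodup_finRange d)]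
  simp

theorem zn_iter_zero {k : Type*} [CommRing k] {d : ℕ} (f : MvPolynomial (Fin d) k) :
    iterPDeriv (0 : Fin d → ℕ) f = f := by
  unfold iterPDeriv
  simp

theorem zn_easy {k : Type*} [Field k] {d : ℕ} (p : Ideal (MvPolynomial (Fin d) k)) [p.IsPrime]
    (n : ℕ) : ∀ f ∈ symbolicPower p (n + 1), ∀ e : Fin d → ℕ, ∑ i, e i ≤ n →
      iterPDeriv e f ∈ p := by
  induction n with
  | zero =>
    intro f hf e he
    have : e = 0 := by
      ext i
      have := Finset.single_le_sum (f := e) (fun _ _ => Nat.zero_le _) (Finset.mem_univ i)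
      simp only [Pi.zero_apply]; omega
    subst this
    rw [zn_iter_zero]
    exact (zn_one p).1 hf
  | succ n ih =>
    intro f hf e he
    by_cases h : e = 0
    · subst h
      rw [zn_iter_zero]
      exact (zn_one p).1 (zn_mono p (by omega) hf)
    · obtain ⟨j, hj⟩ := Function.ne_iff.1 h
      have hle : Pi.single j 1 ≤ e := by
        intro i
        by_cases hij : i = j
        · subst hij; simp at hj ⊢; omega
        · simp [hij]
      obtain ⟨e', rfl⟩ := exists_add_of_le hle
      rw [add_comm, zn_iter_succ]
      refine ih _ (zn_deriv _ p _ hf) _ ?_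
      simp [Finset.sum_add_distrib] at he
      omega

theorem zn_key {k B K : Type*} [Field k] [CommRing B] [CommRing K] [Algebra k B] [Algebra k K]
    {d : ℕ} (g : B →ₐ[k] K) (σ : K →ₐ[k] B) (hσ : ∀ x, g (σ x) = x)
    (hmul : ∀ x y, g x = 0 → g y = 0 → x * y = 0)
    (φ : MvPolynomial (Fin d) k →ₐ[k] B) (y : MvPolynomial (Fin d) k) :
    φ y - σ (g (φ y)) = ∑ i, φ (pderiv i y) * (φ (X i) - σ (g (φ (X i)))) := by
  have hδ : ∀ y, g (φ y - σ (g (φ y))) = 0 := by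
    intro y
    rw [map_sub, sub_eq_zero]
    exact (hσ _).symm
  induction y using MvPolynomial.induction_on with
  | C c =>
    have h1 : φ (C c) = algebraMap k B c := φ.commutes c
    simp [h1]
  | add a b ha hb =>
    simp only [map_add, add_mul, Finset.sum_add_distrib, ← ha, ← hb]
    ring
  | mul_X a j ha =>
    have h0 := hmul _ _ (hδ a) (hδ (X j))
    simp only [pderiv_mul, map_add, map_mul, add_mul, Finset.sum_add_distrib]
    have h1 : ∀ i, φ (pderiv i a) * φ (X j) * (φ (X i) - σ (g (φ (X i)))) =
      φ (X j) * (φ (pderiv i a) * (φ (X i) - σ (g (φ (X i))))) := fun i => by ring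
    simp only [h1, ← Finset.mul_sum, ← ha]
    have h2 : ∑ i, φ a * φ (pderiv i (X j)) * (φ (X i) - σ (g (φ (X i)))) =
        φ a * (φ (X j) - σ (g (φ (X j)))) := by
      rw [Finset.sum_eq_single j]
      · simp
      · intro i _ hij
        rw [pderiv_X_of_ne hij.symm]; simp
      · simp
    rw [h2]
    linear_combination -h0

theorem zn_section {k B K : Type*} [CommRing k] [CommRing B] [CommRing K] [Algebra k B]
    [Algebra k K] [Algebra.FormallySmooth k K] (g : B →ₐ[k] K) (hg : Function.Surjective g)
    (hmul : ∀ x y, g x = 0 → g y = 0 → x * y = 0) :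
    ∃ σ : K →ₐ[k] B, ∀ x, g (σ x) = x := by
  have hnil : IsNilpotent (RingHom.ker (g : B →+* K)) := by
    refine ⟨2, ?_⟩
    rw [pow_two, Ideal.zero_eq_bot, eq_bot_iff, Ideal.mul_le]
    intro x hx y hy
    exact (Submodule.mem_bot _).2 (hmul x y hx hy)
  exact ⟨Algebra.FormallySmooth.liftOfSurjective (AlgHom.id k K) g hg hnil, fun x =>
    Algebra.FormallySmooth.liftOfSurjective_apply (AlgHom.id k K) g hg hnil x⟩

theorem zn_local {k A : Type*} [Field k] [CommRing A] [IsLocalRing A] [Algebra k A]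
    [Algebra.FormallySmooth k (IsLocalRing.ResidueField A)] {d : ℕ}
    (φ : MvPolynomial (Fin d) k →ₐ[k] A) :
    ∃ x : Fin d → A, (∀ i, x i ∈ IsLocalRing.maximalIdeal A) ∧
      ∀ y, φ y ∈ IsLocalRing.maximalIdeal A →
        (∑ i, φ (pderiv i y) * x i) - φ y ∈ IsLocalRing.maximalIdeal A ^ 2 := by
  have hle : ∀ a ∈ IsLocalRing.maximalIdeal A ^ 2,
      IsScalarTower.toAlgHom k A (IsLocalRing.ResidueField A) a = 0 := by
    intro a ha
    exact (IsLocalRing.residue_eq_zero_iff a).2 (Ideal.pow_le_self two_ne_zero ha)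
  obtain ⟨g, hgmk⟩ : ∃ g : (A ⧸ IsLocalRing.maximalIdeal A ^ 2) →ₐ[k] IsLocalRing.ResidueField A,
      ∀ a : A, g (Ideal.Quotient.mk _ a) = IsLocalRing.residue A a :=
    ⟨Ideal.Quotient.liftₐ _ _ hle, fun a => rfl⟩
  have hg : Function.Surjective g := by
    intro x
    obtain ⟨a, rfl⟩ := IsLocalRing.residue_surjective x
    exact ⟨Ideal.Quotient.mk _ a, hgmk a⟩
  have hker : ∀ x, g x = 0 → ∃ a ∈ IsLocalRing.maximalIdeal A, Ideal.Quotient.mk _ a = x := by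
    intro x hx
    obtain ⟨a, rfl⟩ := Ideal.Quotient.mk_surjective x
    rw [hgmk, IsLocalRing.residue_eq_zero_iff] at hx
    exact ⟨a, hx, rfl⟩
  have hmul : ∀ x y, g x = 0 → g y = 0 → x * y = 0 := by
    intro x y hx hy
    obtain ⟨a, ha, rfl⟩ := hker x hx
    obtain ⟨b, hb, rfl⟩ := hker y hy
    rw [← map_mul, Ideal.Quotient.eq_zero_iff_mem, pow_two]
    exact Ideal.mul_mem_mul ha hb
  obtain ⟨σ, hσ⟩ := zn_section g hg hmul
  have key := zn_key g σ hσ hmul ((Ideal.Quotient.mkₐ k _).comp φ)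
  simp only [AlgHom.comp_apply, Ideal.Quotient.mkₐ_eq_mk] at key
  have hδ : ∀ b, g (b - σ (g b)) = 0 := by
    intro b
    rw [map_sub, hσ, sub_self]
  choose x hxm hx using fun i => hker _ (hδ (Ideal.Quotient.mk _ (φ (X i))))
  refine ⟨x, hxm, fun y hy => ?_⟩
  have h1 := key y
  rw [hgmk, (IsLocalRing.residue_eq_zero_iff _).2 hy, map_zero, sub_zero] at h1
  rw [← Ideal.Quotient.eq_zero_iff_mem, map_sub, h1, map_sum, sub_eq_zero]
  refine Finset.sum_congr rfl fun i _ => ?_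
  rw [map_mul, hx]

theorem zn_euler {k : Type*} [Field k] [CharZero k] {d : ℕ}
    (p : Ideal (MvPolynomial (Fin d) k)) [p.IsPrime] :
    ∃ s ∉ p, ∃ a : Fin d → MvPolynomial (Fin d) k, (∀ i, a i ∈ p) ∧
      ∀ y ∈ p, (∑ i, a i * pderiv i y) - s * y ∈ symbolicPower p 2 := by
  have e1 : Algebra.EssFiniteType k (Localization.AtPrime p) :=
    .comp k (MvPolynomial (Fin d) k) _
  have e2 : Algebra.EssFiniteType k (IsLocalRing.ResidueField (Localization.AtPrime p)) :=
    .comp k (Localization.AtPrime p) _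
  obtain ⟨x, hxm, hx⟩ := zn_local (IsScalarTower.toAlgHom k (MvPolynomial (Fin d) k)
    (Localization.AtPrime p))
  simp only [IsScalarTower.coe_toAlgHom'] at hx
  obtain ⟨⟨s, hs⟩, hs'⟩ := IsLocalization.exist_integer_multiples_of_finite p.primeCompl x
  choose a ha using hs'
  have hsp : s ∉ p := hs
  have hsx : ∀ i, algebraMap _ (Localization.AtPrime p) (a i) = algebraMap _ _ s * x i := by
    intro i
    rw [ha i, Algebra.smul_def]
  refine ⟨s, hsp, a, ?_, ?_⟩
  · intro i
    rw [← IsLocalization.AtPrime.to_map_mem_maximal_iff (Localization.AtPrime p) p (a i), hsx]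
    exact Ideal.mul_mem_left _ _ (hxm i)
  · intro y hy
    have h1 := hx y ((IsLocalization.AtPrime.to_map_mem_maximal_iff _ p y).2 hy)
    have h4 : algebraMap _ (Localization.AtPrime p) ((∑ i, a i * pderiv i y) - s * y) ∈
        IsLocalRing.maximalIdeal (Localization.AtPrime p) ^ 2 := by
      convert Ideal.mul_mem_left _ (algebraMap _ (Localization.AtPrime p) s) h1 using 1
      simp only [map_sub, map_sum, map_mul, hsx, mul_sub, Finset.mul_sum]
      congr 1
      exact Finset.sum_congr rfl fun i _ => by ring
    rw [← Localization.AtPrime.map_eq_maximalIdeal, ← Ideal.map_pow,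
      IsLocalization.algebraMap_mem_map_algebraMap_iff p.primeCompl] at h4
    obtain ⟨t, ht, h⟩ := h4
    exact (zn_mem_iff p 2 _).2 ⟨t, ht, h⟩

theorem zn_step {k : Type*} [Field k] [CharZero k] {d : ℕ}
    (p : Ideal (MvPolynomial (Fin d) k)) [p.IsPrime] (n : ℕ) (f : MvPolynomial (Fin d) k)
    (hf : f ∈ symbolicPower p (n + 1)) (hD : ∀ i, pderiv i f ∈ symbolicPower p (n + 1)) :
    f ∈ symbolicPower p (n + 2) := by
  obtain ⟨s, hs, a, ha, hy⟩ := zn_euler p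
  let θ : Derivation k (MvPolynomial (Fin d) k) (MvPolynomial (Fin d) k) :=
    ∑ i, a i • pderiv i
  have hθ : ∀ y, θ y = ∑ i, a i * pderiv i y := by
    intro y
    simp only [θ, ← Derivation.coeFnAddMonoidHom_apply, map_sum, Finset.sum_apply]
    rfl
  have key : ∀ j : ℕ, ∀ y ∈ p ^ (j + 1),
      θ y - ((j + 1 : ℕ) : MvPolynomial (Fin d) k) * s * y ∈ symbolicPower p (j + 2) := by
    intro j
    induction j with
    | zero =>
      intro y h
      rw [hθ]
      simpa using hy y (by simpa using h)
    | succ j ih =>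
      intro y h
      rw [pow_succ] at h
      induction h using Submodule.mul_induction_on' with
      | mem_mul_mem z hz w hw =>
        have h1 := symbolicPower_mul_mem p (zn_pow_le p 1 (by simpa using hw)) (ih z hz)
        have h2 := symbolicPower_mul_mem p (zn_pow_le p (j + 1) hz) (hy w hw)
        rw [← hθ] at h2
        rw [show 1 + (j + 2) = j + 1 + 2 by ring] at h1
        convert Ideal.add_mem _ h1 h2 using 1
        rw [θ.leibniz, smul_eq_mul, smul_eq_mul]
        push_cast
        ring
      | add u _ v _ hu hv =>
        convert Ideal.add_mem _ hu hv using 1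
        rw [map_add]
        ring
  obtain ⟨t, ht, htf⟩ := (zn_mem_iff p _ f).1 hf
  have h1 := key n _ htf
  have ha' : ∀ i, a i ∈ symbolicPower p 1 := fun i => (zn_one p).2 (ha i)
  have h2 : θ (t * f) ∈ symbolicPower p (n + 2) := by
    rw [hθ]
    refine Ideal.sum_mem _ fun i _ => ?_
    rw [show n + 2 = 1 + (n + 1) by ring]
    refine symbolicPower_mul_mem p (ha' i) ?_
    rw [pderiv_mul]
    exact Ideal.add_mem _ (Ideal.mul_mem_left _ _ hf) (Ideal.mul_mem_left _ _ (hD i))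
  have h3 := Ideal.sub_mem _ h2 h1
  rw [sub_sub_cancel] at h3
  have h4 : s * (t * f) ∈ symbolicPower p (n + 2) := by
    have := Ideal.mul_mem_left _ (C ((n + 1 : ℕ) : k)⁻¹) h3
    have hc : C ((n + 1 : ℕ) : k)⁻¹ * ((n + 1 : ℕ) : MvPolynomial (Fin d) k) = 1 := by
      rw [← map_natCast (C : k →+* MvPolynomial (Fin d) k), ← map_mul,
        inv_mul_cancel₀ (Nat.cast_ne_zero.2 (Nat.succ_ne_zero n)), map_one]
    convert this using 1
    linear_combination (-(s * (t * f))) * hc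
  exact zn_cancel p _ ht (zn_cancel p _ hs h4)

theorem zn_hard {k : Type*} [Field k] [CharZero k] {d : ℕ}
    (p : Ideal (MvPolynomial (Fin d) k)) [p.IsPrime] (n : ℕ) :
    ∀ f : MvPolynomial (Fin d) k, (∀ e : Fin d → ℕ, ∑ i, e i ≤ n → iterPDeriv e f ∈ p) →
      f ∈ symbolicPower p (n + 1) := by
  induction n with
  | zero =>
    intro f h
    have := h 0 (by simp)
    rw [zn_iter_zero] at this
    exact (zn_one p).2 this
  | succ n ih =>
    intro f h
    refine zn_step p n f (ih f fun e he => h e (by omega)) fun i => ih _ fun e he => ?_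
    rw [← zn_iter_succ]
    apply h
    simp [Finset.sum_add_distrib]
    omega

end poly

/-- **Zariski–Nagata.** Over an algebraically closed field of characteristic zero, the
`n`-th symbolic power of a prime `p ⊆ k[X_1, …, X_d]` is the `n`-th differential power:
the polynomials all of whose partial derivatives of order at most `n - 1` lie in `p`. -/
theorem zariski_nagata (k : Type*) [Field k] [IsAlgClosed k] [CharZero k]
    (d : ℕ) (p : Ideal (MvPolynomial (Fin d) k)) [p.IsPrime] (n : ℕ) (hn : 0 < n) :
    ∀ f : MvPolynomial (Fin d) k,
      f ∈ symbolicPower p n ↔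
        ∀ e : Fin d → ℕ, (∑ i, e i) ≤ n - 1 → iterPDeriv e f ∈ p := by
  intro f
  obtain ⟨n, rfl⟩ : ∃ m, n = m + 1 := ⟨n - 1, by omega⟩
  exact ⟨fun hf => zn_easy p n f hf, fun h => zn_hard p n f h⟩
end
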